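/- arXiv:1905.02309 — 5 statements merged into one kernel-verified Lean document; each statement's English description precedes it below -/
import Mathlib

section
/- Fix an integer k ≥ 2 and a nonempty set T of sum indecomposable permutation patterns. Then the limits lim_{n→∞} |Av_n(T)|^{1/n} and lim_{n→∞} |H_n^k(T)|^{1/n} both exist (as elements of the extended nonnegative reals [0,∞]) and are equal. -/
open Filter Topology
open scoped ENNReal

/-- `σ ∈ S_n` contains the pattern `τ ∈ S_m`. -/
def PermContains {n m : ℕ} (σ : Equiv.Perm (Fin n)) (τ : Equiv.Perm (Fin m)) : Prop :=
  ∃ f : Fin m → Fin n, StrictMono f ∧ ∀ j k : Fin m, σ (f j) < σ (f k) ↔ τ j < τ k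

/-- `σ` avoids every pattern in the set `T`. -/
def AvoidsAll {n : ℕ} (σ : Equiv.Perm (Fin n)) (T : Set (Σ m, Equiv.Perm (Fin m))) : Prop :=
  ∀ τ ∈ T, ¬ PermContains σ τ.2

/-- The direct sum `λ ⊕ μ` of two permutations. -/
def directSum {l m : ℕ} (lam : Equiv.Perm (Fin l)) (mu : Equiv.Perm (Fin m)) :
    Equiv.Perm (Fin (l + m)) :=
  finSumFinEquiv.symm.trans ((Equiv.sumCongr lam mu).trans finSumFinEquiv)

/-- A permutation is sum indecomposable if it is not a direct sum of two shorter permutations. -/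
def SumIndecomposable {n : ℕ} (σ : Equiv.Perm (Fin n)) : Prop :=
  ¬ ∃ (l m : ℕ) (_ : 0 < l) (_ : 0 < m) (lam : Equiv.Perm (Fin l)) (mu : Equiv.Perm (Fin m))
      (h : l + m = n), σ = h ▸ directSum lam mu

/-- `σ ∈ S_n` is the permutation associated to a `k`-ary heap: in 1-indexed terms,
`σ(⌈(i−1)/k⌉) < σ(i)` for all `2 ≤ i ≤ n`; here `i : Fin n` is the 0-indexed vertex,
whose 0-indexed parent is `(i−1)/k` (floor division). -/
def IsHeapPerm (k : ℕ) {n : ℕ} (σ : Equiv.Perm (Fin n)) : Prop :=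
  ∀ i : Fin n, 1 ≤ (i : ℕ) →
    σ ⟨((i : ℕ) - 1) / k,
        lt_of_le_of_lt (le_trans (Nat.div_le_self _ _) (Nat.sub_le _ _)) i.isLt⟩ < σ i

/-- `|Av_n(T)|`. -/
noncomputable def avCount (T : Set (Σ m, Equiv.Perm (Fin m))) (n : ℕ) : ℕ :=
  Nat.card {σ : Equiv.Perm (Fin n) // AvoidsAll σ T}

/-- `|H_n^k(T)|`. -/
noncomputable def heapCount (k : ℕ) (T : Set (Σ m, Equiv.Perm (Fin m))) (n : ℕ) : ℕ :=
  Nat.card {σ : Equiv.Perm (Fin n) // IsHeapPerm k σ ∧ AvoidsAll σ T}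

theorem directSum_castAdd {l m : ℕ} (σ : Equiv.Perm (Fin l)) (ρ : Equiv.Perm (Fin m))
    (i : Fin l) : directSum σ ρ (Fin.castAdd m i) = Fin.castAdd m (σ i) := by
  simp [directSum]

theorem directSum_natAdd {l m : ℕ} (σ : Equiv.Perm (Fin l)) (ρ : Equiv.Perm (Fin m))
    (i : Fin m) : directSum σ ρ (Fin.natAdd l i) = Fin.natAdd l (ρ i) := by
  simp [directSum]

theorem directSum_lt_iff {l m : ℕ} (σ : Equiv.Perm (Fin l)) (ρ : Equiv.Perm (Fin m))
    (i : Fin (l + m)) : (directSum σ ρ i : ℕ) < l ↔ (i : ℕ) < l := by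
  induction i using Fin.addCases with
  | left i => simp [directSum_castAdd]
  | right i => simp [directSum_natAdd]

theorem directSum_injective {l m : ℕ} {σ σ' : Equiv.Perm (Fin l)} {ρ ρ' : Equiv.Perm (Fin m)}
    (h : directSum σ ρ = directSum σ' ρ') : σ = σ' ∧ ρ = ρ' := by
  constructor
  · ext i
    have := congrArg (fun e => ((e (Fin.castAdd m i) : Fin (l + m)) : ℕ)) h
    simpa [directSum_castAdd] using this
  · ext i
    have := congrArg (fun e => ((e (Fin.natAdd l i) : Fin (l + m)) : ℕ)) h
    simpa [directSum_natAdd] using this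

/-- A permutation whose first `l` values all lie below the remaining ones is decomposable. -/
theorem not_sumIndecomposable_of_forall_lt {m : ℕ} (τ : Equiv.Perm (Fin m)) (l : ℕ)
    (hl : 0 < l) (hlm : l < m)
    (h : ∀ a b : Fin m, (a : ℕ) < l → l ≤ (b : ℕ) → τ a < τ b) : ¬ SumIndecomposable τ := by
  obtain ⟨p, rfl⟩ : ∃ p, m = l + (p + 1) := Nat.exists_eq_add_of_lt hlm
  have key : ∀ a : Fin (l + (p + 1)), (a : ℕ) < l → (τ a : ℕ) < l := by
    intro a ha
    by_contra! hcon
    have hlt : ∀ b : Fin (p + 1), (τ (Fin.natAdd l b) : ℕ) - (l + 1) < p := by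
      intro b
      have h1 : τ a < τ (Fin.natAdd l b) := h a (Fin.natAdd l b) ha (by simp)
      have h2 := (τ (Fin.natAdd l b)).isLt
      have h3 : (τ a : ℕ) < τ (Fin.natAdd l b) := h1
      omega
    have := Fintype.card_le_of_injective
      (fun b : Fin (p + 1) => (⟨(τ (Fin.natAdd l b) : ℕ) - (l + 1), hlt b⟩ : Fin p)) (by
        intro b c hbc
        have hb : (τ a : ℕ) < τ (Fin.natAdd l b) := h a (Fin.natAdd l b) ha (by simp)
        have hc : (τ a : ℕ) < τ (Fin.natAdd l c) := h a (Fin.natAdd l c) ha (by simp)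
        have hbc' := congrArg Fin.val hbc
        simp only at hbc'
        have : τ (Fin.natAdd l b) = τ (Fin.natAdd l c) := Fin.ext (by omega)
        simpa using this)
    simp at this
  have hmaps : Set.MapsTo (finSumFinEquiv.symm.permCongr τ)
      (Set.range (Sum.inl : Fin l → Fin l ⊕ Fin (p + 1))) (Set.range Sum.inl) := by
    rintro _ ⟨i, rfl⟩
    refine ⟨⟨τ (Fin.castAdd _ i), key _ (by simp)⟩, ?_⟩
    rw [Equiv.permCongr_apply, Equiv.eq_symm_apply]
    ext
    simp
  obtain ⟨⟨lam, mu⟩, hlm'⟩ := Equiv.Perm.mem_sumCongrHom_range_of_perm_mapsTo_inl hmaps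
  refine fun hind => hind ⟨l, p + 1, hl, Nat.succ_pos p, lam, mu, rfl, ?_⟩
  have hsum : Equiv.sumCongr lam mu = finSumFinEquiv.symm.permCongr τ := hlm'
  ext i
  simp [directSum, hsum, Equiv.permCongr_apply]

theorem permContains_or_of_directSum {l n m : ℕ} {σ : Equiv.Perm (Fin l)}
    {ρ : Equiv.Perm (Fin n)} {τ : Equiv.Perm (Fin m)} (hτ : SumIndecomposable τ)
    (h : PermContains (directSum σ ρ) τ) : PermContains σ τ ∨ PermContains ρ τ := by
  obtain ⟨f, hf, hfτ⟩ := h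
  by_cases hlow : ∀ j, (f j : ℕ) < l
  · refine .inl ⟨fun j => ⟨f j, hlow j⟩, fun a b hab => hf hab, fun a b => ?_⟩
    rw [← hfτ]
    have hcast : ∀ j, f j = Fin.castAdd n ⟨f j, hlow j⟩ := fun j => rfl
    rw [hcast a, hcast b, directSum_castAdd, directSum_castAdd]
    exact Iff.rfl
  by_cases hhigh : ∀ j, l ≤ (f j : ℕ)
  · have hsub : ∀ j, (f j : ℕ) - l < n := fun j => by
      have := hhigh j
      have := (f j).isLt
      omega
    have hnat : ∀ j, f j = Fin.natAdd l ⟨(f j : ℕ) - l, hsub j⟩ := fun j =>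
      Fin.ext (by have := hhigh j; simp; omega)
    refine .inr ⟨fun j => ⟨(f j : ℕ) - l, hsub j⟩, fun a b hab => ?_, fun a b => ?_⟩
    · have h1 : (f a : ℕ) < f b := hf hab
      have := hhigh a
      simp only [Fin.lt_def]
      omega
    · rw [← hfτ, hnat a, hnat b, directSum_natAdd, directSum_natAdd]
      simp
  exfalso
  push Not at hlow hhigh
  obtain ⟨j₀, hj₀⟩ := hhigh
  classical
  have hex : ∃ s : ℕ, ∃ j : Fin m, (j : ℕ) = s ∧ l ≤ (f j : ℕ) := by
    obtain ⟨j, hj⟩ := hlow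
    exact ⟨j, j, rfl, hj⟩
  obtain ⟨j₁, hj₁, hfj₁⟩ := Nat.find_spec hex
  have hbelow : ∀ a : Fin m, (a : ℕ) < Nat.find hex → (f a : ℕ) < l := by
    intro a ha
    by_contra! hcon
    exact Nat.find_min hex ha ⟨a, rfl, hcon⟩
  have habove : ∀ b : Fin m, Nat.find hex ≤ (b : ℕ) → l ≤ (f b : ℕ) := by
    intro b hb
    have : f j₁ ≤ f b := hf.monotone (by rw [Fin.le_def]; omega)
    exact hfj₁.trans this
  refine not_sumIndecomposable_of_forall_lt τ (Nat.find hex) ?_ ?_ ?_ hτ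
  · by_contra! hcon
    have := habove j₀ (by omega)
    omega
  · rw [← hj₁]
    exact j₁.isLt
  · intro a b ha hb
    rw [← hfτ, Fin.lt_def]
    have h1 := (directSum_lt_iff σ ρ (f a)).2 (hbelow a ha)
    have h2 := mt (directSum_lt_iff σ ρ (f b)).1 (by have := habove b hb; omega)
    omega

theorem AvoidsAll.directSum {T : Set (Σ m, Equiv.Perm (Fin m))}
    (hT : ∀ τ ∈ T, SumIndecomposable τ.2) {l n : ℕ} {σ : Equiv.Perm (Fin l)}
    {ρ : Equiv.Perm (Fin n)} (hσ : AvoidsAll σ T) (hρ : AvoidsAll ρ T) :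
    AvoidsAll (directSum σ ρ) T := fun τ hτ h =>
  (permContains_or_of_directSum (hT τ hτ) h).elim (hσ τ hτ) (hρ τ hτ)

/-- Appending a block that spans no edge of the tree preserves the heap property. -/
theorem IsHeapPerm.directSum {k l n : ℕ} (hk : 2 ≤ k) (hnl : n ≤ l) {σ : Equiv.Perm (Fin l)}
    (hσ : IsHeapPerm k σ) (ρ : Equiv.Perm (Fin n)) : IsHeapPerm k (directSum σ ρ) := by
  intro i
  induction i using Fin.addCases with
  | left i =>
    intro hi
    have hlt := hσ i hi
    rw [directSum_castAdd, Fin.lt_def]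
    exact lt_of_eq_of_lt (congrArg Fin.val (directSum_castAdd σ ρ ⟨((i : ℕ) - 1) / k, _⟩)) hlt
  | right i =>
    intro hi
    rw [Fin.lt_def]
    have h1 : l ≤ (_root_.directSum σ ρ (Fin.natAdd l i) : ℕ) := by simp [directSum_natAdd]
    refine lt_of_lt_of_le ((directSum_lt_iff σ ρ _).2 ?_) h1
    have := i.isLt
    refine Nat.div_lt_of_lt_mul ?_
    simp only [Fin.val_natAdd]
    have := Nat.mul_le_mul_right l hk
    omega

theorem isHeapPerm_one (k n : ℕ) : IsHeapPerm k (1 : Equiv.Perm (Fin n)) := by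
  intro i hi
  have : ((i : ℕ) - 1) / k ≤ (i : ℕ) - 1 := Nat.div_le_self _ _
  simp only [Equiv.Perm.one_apply, Fin.lt_def]
  omega

theorem two_le_of_avoidsAll {T : Set (Σ m, Equiv.Perm (Fin m))} {n : ℕ} (hn : 0 < n)
    {σ : Equiv.Perm (Fin n)} (hσ : AvoidsAll σ T) (τ : Σ m, Equiv.Perm (Fin m)) (hτ : τ ∈ T) :
    2 ≤ τ.1 := by
  by_contra! hlt
  have : Subsingleton (Fin τ.1) := Fin.subsingleton_iff_le_one.2 (by omega)
  exact hσ τ hτ ⟨fun _ => ⟨0, hn⟩, Subsingleton.strictMono _, fun a b => by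
    simp [Subsingleton.elim a b]⟩

theorem avoidsAll_one {T : Set (Σ m, Equiv.Perm (Fin m))} (hT : ∀ τ ∈ T, SumIndecomposable τ.2)
    (h2 : ∀ τ ∈ T, 2 ≤ τ.1) (n : ℕ) : AvoidsAll (1 : Equiv.Perm (Fin n)) T := by
  rintro τ hτ ⟨f, hf, h⟩
  refine not_sumIndecomposable_of_forall_lt τ.2 1 one_pos (h2 τ hτ) (fun a b ha hb => ?_) (hT τ hτ)
  rw [← h]
  exact hf (by rw [Fin.lt_def]; omega)

theorem heapCount_le_avCount (k : ℕ) (T : Set (Σ m, Equiv.Perm (Fin m))) (n : ℕ) :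
    heapCount k T n ≤ avCount T n :=
  Nat.card_le_card_of_injective (fun σ => ⟨σ.1, σ.2.2⟩) fun σ ρ h => by
    simpa [Subtype.ext_iff] using h

theorem heapCount_mul_avCount_le {k : ℕ} (hk : 2 ≤ k) {T : Set (Σ m, Equiv.Perm (Fin m))}
    (hT : ∀ τ ∈ T, SumIndecomposable τ.2) {l n : ℕ} (hnl : n ≤ l) :
    heapCount k T l * avCount T n ≤ heapCount k T (l + n) := by
  rw [heapCount, avCount, ← Nat.card_prod]
  refine Nat.card_le_card_of_injective (fun p => ⟨directSum p.1.1 p.2.1,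
    p.1.2.1.directSum hk hnl _, p.1.2.2.directSum hT p.2.2⟩) ?_
  rintro ⟨σ, ρ⟩ ⟨σ', ρ'⟩ h
  obtain ⟨h1, h2⟩ := directSum_injective (congrArg Subtype.val h)
  exact Prod.ext (Subtype.ext h1) (Subtype.ext h2)

theorem one_le_heapCount (k : ℕ) {T : Set (Σ m, Equiv.Perm (Fin m))}
    (hT : ∀ τ ∈ T, SumIndecomposable τ.2) {M : ℕ} (hM : 0 < M) (ha : avCount T M ≠ 0) (n : ℕ) :
    1 ≤ heapCount k T n := by
  obtain ⟨⟨σ, hσ⟩⟩ := (Nat.card_ne_zero.1 ha).1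
  have : Nonempty {σ : Equiv.Perm (Fin n) // IsHeapPerm k σ ∧ AvoidsAll σ T} :=
    ⟨1, isHeapPerm_one k n, avoidsAll_one hT (two_le_of_avoidsAll hM hσ) n⟩
  exact Nat.card_pos

theorem avCount_pow_le_heapCount {k : ℕ} (hk : 2 ≤ k) {T : Set (Σ m, Equiv.Perm (Fin m))}
    (hT : ∀ τ ∈ T, SumIndecomposable τ.2) {M : ℕ} (hM : 0 < M) (ha : avCount T M ≠ 0)
    {l : ℕ} (hl : M ≤ l) (q : ℕ) : avCount T M ^ q ≤ heapCount k T (l + q * M) := by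
  induction q with
  | zero => simpa using one_le_heapCount k hT hM ha l
  | succ q ih =>
    calc avCount T M ^ (q + 1) = avCount T M ^ q * avCount T M := pow_succ _ _
      _ ≤ heapCount k T (l + q * M) * avCount T M := Nat.mul_le_mul_right _ ih
      _ ≤ heapCount k T (l + q * M + M) := heapCount_mul_avCount_le hk hT (by omega)
      _ = heapCount k T (l + (q + 1) * M) := by congr 1; ring

theorem avCount_rpow_le_heapCount_rpow {k : ℕ} (hk : 2 ≤ k)
    {T : Set (Σ m, Equiv.Perm (Fin m))} (hT : ∀ τ ∈ T, SumIndecomposable τ.2) {M : ℕ}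
    (hM : 0 < M) (ha : avCount T M ≠ 0) {n : ℕ} (hn : M ≤ n) :
    (avCount T M : ℝ≥0∞) ^ (1 / (M : ℝ) - 2 / (n : ℝ)) ≤
      (heapCount k T n : ℝ≥0∞) ^ (1 / (n : ℝ)) := by
  obtain ⟨d, rfl⟩ := Nat.exists_eq_add_of_le hn
  have hdm : d % M + M * (d / M) = d := Nat.mod_add_div d M
  have hmod : d % M < M := Nat.mod_lt d hM
  have hpow := avCount_pow_le_heapCount hk hT hM ha (l := M + d % M) (by omega) (d / M)
  rw [show M + d % M + d / M * M = M + d by rw [mul_comm (d / M)]; omega] at hpow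
  have hM' : (0 : ℝ) < M := by exact_mod_cast hM
  have hn' : (0 : ℝ) < ((M + d : ℕ) : ℝ) := by exact_mod_cast (by omega : 0 < M + d)
  have hexp : 1 / (M : ℝ) - 2 / ((M + d : ℕ) : ℝ) ≤
      ((d / M : ℕ) : ℝ) * (1 / ((M + d : ℕ) : ℝ)) := by
    have hle : ((M + d : ℕ) : ℝ) ≤ 2 * M + M * ((d / M : ℕ) : ℝ) := by
      exact_mod_cast (by omega : M + d ≤ 2 * M + M * (d / M))
    rw [div_sub_div _ _ hM'.ne' hn'.ne', mul_one_div, div_le_div_iff₀ (by positivity) hn']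
    nlinarith
  calc (avCount T M : ℝ≥0∞) ^ (1 / (M : ℝ) - 2 / ((M + d : ℕ) : ℝ))
      ≤ (avCount T M : ℝ≥0∞) ^ (((d / M : ℕ) : ℝ) * (1 / ((M + d : ℕ) : ℝ))) :=
        ENNReal.rpow_le_rpow_of_exponent_le
          (by exact_mod_cast Nat.one_le_iff_ne_zero.2 ha) hexp
    _ = ((avCount T M ^ (d / M) : ℕ) : ℝ≥0∞) ^ (1 / ((M + d : ℕ) : ℝ)) := by
        rw [ENNReal.rpow_mul, ENNReal.rpow_natCast, Nat.cast_pow]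
    _ ≤ _ := ENNReal.rpow_le_rpow (by exact_mod_cast hpow) (by positivity)

theorem tendsto_natCast_rpow_sub {a : ℕ} (ha : a ≠ 0) (x : ℝ) :
    Tendsto (fun n : ℕ => (a : ℝ≥0∞) ^ (x - 2 / (n : ℝ))) atTop (𝓝 ((a : ℝ≥0∞) ^ x)) := by
  have hexp : Tendsto (fun n : ℕ => x - 2 / (n : ℝ)) atTop (𝓝 x) := by
    simpa using tendsto_const_nhds.sub (tendsto_const_div_atTop_nhds_zero_nat (2 : ℝ))
  have ha' : (0 : ℝ) < a := by exact_mod_cast Nat.pos_of_ne_zero ha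
  have hreal := (Real.continuousAt_const_rpow ha'.ne').tendsto.comp hexp
  have := ENNReal.tendsto_ofReal hreal
  simpa [Function.comp_def, ← ENNReal.ofReal_rpow_of_pos ha'] using this

theorem eventually_lt_heapCount_rpow {k : ℕ} (hk : 2 ≤ k) {T : Set (Σ m, Equiv.Perm (Fin m))}
    (hT : ∀ τ ∈ T, SumIndecomposable τ.2) {M : ℕ} (hM : 0 < M) {c : ℝ≥0∞}
    (hc : c < (avCount T M : ℝ≥0∞) ^ (1 / (M : ℝ))) :
    ∀ᶠ n : ℕ in atTop, c < (heapCount k T n : ℝ≥0∞) ^ (1 / (n : ℝ)) := by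
  have ha : avCount T M ≠ 0 := by
    intro h0
    have : (0 : ℝ) < 1 / (M : ℝ) := by positivity
    rw [h0, Nat.cast_zero, ENNReal.zero_rpow_of_pos this] at hc
    exact not_lt_bot hc
  filter_upwards [(tendsto_natCast_rpow_sub ha _).eventually_const_lt hc, eventually_ge_atTop M]
    with n hn hMn
  exact hn.trans_le (avCount_rpow_le_heapCount_rpow hk hT hM ha hMn)

/-- **Theorem 1.** For `k ≥ 2` and a nonempty set `T` of sum indecomposable patterns,
`lim |Av_n(T)|^{1/n}` and `lim |H_n^k(T)|^{1/n}` both exist in `[0,∞]` and are equal. -/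
theorem heap_growth_eq_av_growth (k : ℕ) (hk : 2 ≤ k)
    (T : Set (Σ m, Equiv.Perm (Fin m))) (hne : T.Nonempty)
    (hT : ∀ τ ∈ T, SumIndecomposable τ.2) :
    ∃ L : ℝ≥0∞,
      Tendsto (fun n : ℕ => (avCount T n : ℝ≥0∞) ^ (1 / (n : ℝ))) atTop (𝓝 L) ∧
      Tendsto (fun n : ℕ => (heapCount k T n : ℝ≥0∞) ^ (1 / (n : ℝ))) atTop (𝓝 L) := by
  have hle : ∀ n : ℕ, (heapCount k T n : ℝ≥0∞) ^ (1 / (n : ℝ)) ≤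
      (avCount T n : ℝ≥0∞) ^ (1 / (n : ℝ)) := fun n =>
    ENNReal.rpow_le_rpow (by exact_mod_cast heapCount_le_avCount k T n) (by positivity)
  set L : ℝ≥0∞ := ⨆ M : {M : ℕ // 0 < M}, (avCount T M : ℝ≥0∞) ^ (1 / ((M : ℕ) : ℝ)) with hL
  have hlow : ∀ c < L, ∀ᶠ n : ℕ in atTop, c < (heapCount k T n : ℝ≥0∞) ^ (1 / (n : ℝ)) := by
    intro c hc
    obtain ⟨M, hM⟩ := lt_iSup_iff.1 hc
    exact eventually_lt_heapCount_rpow hk hT M.2 hM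
  have hup : ∀ᶠ n : ℕ in atTop, (avCount T n : ℝ≥0∞) ^ (1 / (n : ℝ)) ≤ L := by
    filter_upwards [eventually_gt_atTop 0] with n hn
    exact le_iSup (fun M : {M : ℕ // 0 < M} =>
      (avCount T M : ℝ≥0∞) ^ (1 / ((M : ℕ) : ℝ))) ⟨n, hn⟩
  refine ⟨L, tendsto_order.2 ⟨fun c hc => ?_, fun c hc => ?_⟩,
    tendsto_order.2 ⟨hlow, fun c hc => ?_⟩⟩
  · filter_upwards [hlow c hc] with n hn using hn.trans_le (hle n)
  · filter_upwards [hup] with n hn using hn.trans_lt hc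
  · filter_upwards [hup] with n hn using ((hle n).trans hn).trans_lt hc
end

section
/- For every integer k ≥ 2, lim_{n→∞} |H_n^k(321)|^{1/n} = 4, where 321 denotes the decreasing pattern of length 3. -/
open Filter Topology
open scoped ENNReal

/-- The pattern `321` (0-indexed: the order-reversing permutation of `Fin 3`). -/
def pat321 : Equiv.Perm (Fin 3) := ⟨![2, 1, 0], ![2, 1, 0], by decide, by decide⟩

theorem avoidsAll_pat321_iff {n : ℕ} (σ : Equiv.Perm (Fin n)) :
    AvoidsAll σ {(⟨3, pat321⟩ : Σ m, Equiv.Perm (Fin m))} ↔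
      ∀ a b c : Fin n, a < b → b < c → σ c < σ b → ¬ σ b < σ a := by
  constructor
  · intro h a b c hab hbc hcb hba
    refine h _ rfl ⟨![a, b, c], ?_, ?_⟩
    · intro i j hij
      fin_cases i <;> fin_cases j <;> simp_all
      exact hab.trans hbc
    · intro i j
      have hca := hcb.trans hba
      fin_cases i <;> fin_cases j <;>
        simp [pat321, hcb, hba, hca, hcb.le, hba.le, hca.le]
  · rintro h τ rfl ⟨f, hf, hτ⟩
    have h01 : f 0 < f 1 := hf (by decide)
    have h12 : f 1 < f 2 := hf (by decide)
    exact h _ _ _ h01 h12 ((hτ 2 1).2 (by decide)) ((hτ 1 0).2 (by decide))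

/-- The positions of the left-to-right maxima of `σ`. -/
def leftRightMaxima {n : ℕ} (σ : Equiv.Perm (Fin n)) : Finset (Fin n) :=
  {i | ∀ h < i, σ h < σ i}

theorem StrictMonoOn.eqOn_of_image_eq {n : ℕ} {f g : Fin n → Fin n} {s : Set (Fin n)}
    (hf : StrictMonoOn f s) (hg : StrictMonoOn g s) (h : f '' s = g '' s) : Set.EqOn f g s := by
  have := (hf.strictMono.range_inj hg.strictMono).1 (by rw [Set.range_comp, Set.range_comp, Subtype.range_coe, h])
  exact fun x hx ↦ congrFun this ⟨x, hx⟩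

theorem strictMonoOn_leftRightMaxima {n : ℕ} (σ : Equiv.Perm (Fin n)) :
    StrictMonoOn σ (leftRightMaxima σ : Set (Fin n)) := by
  intro x _ y hy hxy
  simp only [leftRightMaxima, Finset.coe_filter, Finset.mem_univ, true_and] at hy
  exact hy x hxy

theorem strictMonoOn_compl_leftRightMaxima {n : ℕ} {σ : Equiv.Perm (Fin n)}
    (h : AvoidsAll σ {(⟨3, pat321⟩ : Σ m, Equiv.Perm (Fin m))}) :
    StrictMonoOn σ (leftRightMaxima σ : Set (Fin n))ᶜ := by
  intro x hx y _ hxy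
  simp only [leftRightMaxima, Finset.coe_filter, Finset.mem_univ, true_and, Set.mem_compl_iff,
    Set.mem_ofPred_eq, not_forall, not_lt] at hx
  obtain ⟨w, hwx, hw⟩ := hx
  by_contra! hyx
  refine (avoidsAll_pat321_iff σ).1 h w x y hwx hxy ?_ ?_
  · exact lt_of_le_of_ne hyx fun e ↦ hxy.ne' (σ.injective e)
  · exact lt_of_le_of_ne hw fun e ↦ hwx.ne' (σ.injective e)

theorem heapCount_pat321_le (k n : ℕ) :
    heapCount k {(⟨3, pat321⟩ : Σ m, Equiv.Perm (Fin m))} n ≤ 4 ^ n := by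
  have hcard : Nat.card (Finset (Fin n) × Finset (Fin n)) = 4 ^ n := by
    simp [← mul_pow]
  rw [← hcard]
  refine Nat.card_le_card_of_injective
    (fun σ ↦ (leftRightMaxima σ.1, (leftRightMaxima σ.1).image σ.1)) ?_
  rintro ⟨σ, _, hσ⟩ ⟨τ, _, hτ⟩ hστ
  simp only [Prod.mk.injEq] at hστ
  obtain ⟨hpos, hval⟩ := hστ
  have hval' : σ '' (leftRightMaxima σ : Set (Fin n)) = τ '' (leftRightMaxima σ) := by
    have := congrArg (fun s : Finset (Fin n) ↦ (s : Set (Fin n))) hval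
    simp only [Finset.coe_image] at this
    rw [this, hpos]
  have h₁ := (strictMonoOn_leftRightMaxima σ).eqOn_of_image_eq
    (hpos ▸ strictMonoOn_leftRightMaxima τ) hval'
  have h₂ := (strictMonoOn_compl_leftRightMaxima hσ).eqOn_of_image_eq
    (hpos ▸ strictMonoOn_compl_leftRightMaxima hτ)
    (by rw [Set.image_compl_eq σ.bijective, Set.image_compl_eq τ.bijective, hval'])
  refine Subtype.ext (Equiv.ext fun x ↦ ?_)
  by_cases hx : x ∈ (leftRightMaxima σ : Set (Fin n))
  · exact h₁ hx
  · exact h₂ hx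

theorem Nat.exists_count_eq_of_lt {p : ℕ → Prop} [DecidablePred p] {n c : ℕ}
    (h : c < Nat.count p n) : ∃ y < n, p y ∧ Nat.count p y = c := by
  induction n with
  | zero => simp at h
  | succ n ih =>
    by_cases hc : c < Nat.count p n
    · obtain ⟨y, hy, hp⟩ := ih hc
      exact ⟨y, by omega, hp⟩
    · rw [Nat.count_succ] at h
      split_ifs at h with hp
      · exact ⟨n, by omega, hp, by omega⟩
      · omega

theorem Nat.count_add_count_not (p : ℕ → Prop) [DecidablePred p] (n : ℕ) :
    Nat.count p n + Nat.count (fun x ↦ ¬ p x) n = n := by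
  induction n with
  | zero => simp
  | succ n ih => rw [Nat.count_succ, Nat.count_succ]; split_ifs <;> omega

/-- `σ` sends the solutions of `A` to those of `B`, preserving ranks, and likewise for the
complements. -/
def RankMatches (A B : ℕ → Prop) [DecidablePred A] [DecidablePred B] {n : ℕ}
    (σ : Equiv.Perm (Fin n)) : Prop :=
  ∀ x : Fin n,
    (A x ∧ B (σ x) ∧ Nat.count A x = Nat.count B (σ x)) ∨
    (¬ A x ∧ ¬ B (σ x) ∧ Nat.count (fun y ↦ ¬ A y) x = Nat.count (fun y ↦ ¬ B y) (σ x))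

theorem exists_rankMatches {A B : ℕ → Prop} [DecidablePred A] [DecidablePred B] {n : ℕ}
    (h : Nat.count A n = Nat.count B n) : ∃ σ : Equiv.Perm (Fin n), RankMatches A B σ := by
  have hA := Nat.count_add_count_not A n
  have hB := Nat.count_add_count_not B n
  have hex : ∀ x : Fin n, ∃ y : Fin n,
      (A x ∧ B y ∧ Nat.count A x = Nat.count B y) ∨
      (¬ A x ∧ ¬ B y ∧ Nat.count (fun y ↦ ¬ A y) x = Nat.count (fun y ↦ ¬ B y) y) := by
    intro x
    by_cases hx : A x
    · have := Nat.count_strict_mono hx x.2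
      obtain ⟨y, hy, hBy, hc⟩ := Nat.exists_count_eq_of_lt (this.trans_eq h)
      exact ⟨⟨y, hy⟩, Or.inl ⟨hx, hBy, hc.symm⟩⟩
    · have := Nat.count_strict_mono (p := fun y ↦ ¬ A y) hx x.2
      obtain ⟨y, hy, hBy, hc⟩ := Nat.exists_count_eq_of_lt
        (this.trans_eq (show _ = Nat.count (fun y ↦ ¬ B y) n by omega))
      exact ⟨⟨y, hy⟩, Or.inr ⟨hx, hBy, hc.symm⟩⟩
  choose f hf using hex
  have hinj : Function.Injective f := by
    intro x x' hxx
    rcases hf x with ⟨h1, h2, h3⟩ | ⟨h1, h2, h3⟩ <;>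
    rcases hf x' with ⟨h1', h2', h3'⟩ | ⟨h1', h2', h3'⟩ <;> rw [← hxx] at h2' h3'
    · exact Fin.ext (Nat.count_injective h1 h1' (h3.trans h3'.symm))
    · exact absurd h2 h2'
    · exact absurd h2' h2
    · exact Fin.ext (Nat.count_injective (p := fun y ↦ ¬ A y) h1 h1' (h3.trans h3'.symm))
  exact ⟨Equiv.ofBijective f (Finite.injective_iff_bijective.1 hinj), hf⟩


namespace RankMatches

variable {A B : ℕ → Prop} [DecidablePred A] [DecidablePred B] {n : ℕ} {σ : Equiv.Perm (Fin n)}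

theorem apply_iff (hσ : RankMatches A B σ) (x : Fin n) : B (σ x) ↔ A x := by
  have := hσ x
  tauto

theorem lt_of_pos (hσ : RankMatches A B σ) {x y : Fin n} (hx : A x) (hy : A y) (hxy : x < y) :
    σ x < σ y := by
  obtain ⟨-, -, h₁⟩ | h₁ := hσ x
  · obtain ⟨-, -, h₂⟩ | h₂ := hσ y
    · exact Nat.lt_of_count_lt_count (h₁ ▸ h₂ ▸ Nat.count_strict_mono hx hxy)
    · exact absurd hy h₂.1
  · exact absurd hx h₁.1

theorem lt_of_neg (hσ : RankMatches A B σ) {x y : Fin n} (hx : ¬ A x) (hy : ¬ A y)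
    (hxy : x < y) : σ x < σ y := by
  obtain h₁ | ⟨-, -, h₁⟩ := hσ x
  · exact absurd h₁.1 hx
  · obtain h₂ | ⟨-, -, h₂⟩ := hσ y
    · exact absurd h₂.1 hy
    · refine Nat.lt_of_count_lt_count (p := fun y ↦ ¬ B y) ?_
      rw [← h₁, ← h₂]
      exact Nat.count_strict_mono (p := fun y ↦ ¬ A y) hx hxy

theorem avoidsAll_pat321 (hσ : RankMatches A B σ) :
    AvoidsAll σ {(⟨3, pat321⟩ : Σ m, Equiv.Perm (Fin m))} := by
  rw [avoidsAll_pat321_iff]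
  intro a b c hab hbc hcb hba
  by_cases ha : A a <;> by_cases hb : A b <;> by_cases hc : A c
  · exact (hσ.lt_of_pos ha hb hab).asymm hba
  · exact (hσ.lt_of_pos ha hb hab).asymm hba
  · exact (hσ.lt_of_pos ha hc (hab.trans hbc)).asymm (hcb.trans hba)
  · exact (hσ.lt_of_neg hb hc hbc).asymm hcb
  · exact (hσ.lt_of_pos hb hc hbc).asymm hcb
  · exact (hσ.lt_of_neg ha hc (hab.trans hbc)).asymm (hcb.trans hba)
  · exact (hσ.lt_of_neg ha hb hab).asymm hba
  · exact (hσ.lt_of_neg ha hb hab).asymm hba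

theorem lt_apply_iff (hσ : RankMatches A B σ) (h : ∀ x, Nat.count B (x + 1) ≤ Nat.count A x)
    (x : Fin n) : x < σ x ↔ A x := by
  rw [Fin.lt_def]
  obtain ⟨hA, hB, hc⟩ | ⟨hA, hB, hc⟩ := hσ x
  · refine iff_of_true (Nat.lt_of_succ_lt_succ ?_) hA
    refine Nat.lt_of_count_lt_count (p := B) ?_
    have h₁ := Nat.count_succ B (σ x)
    rw [if_pos hB] at h₁
    have h₂ := h x
    simp only [Nat.succ_eq_add_one]
    omega
  · refine iff_of_false (fun hlt ↦ ?_) hA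
    have h₁ := Nat.count_add_count_not A (x + 1)
    have h₂ := Nat.count_add_count_not B (x + 1)
    have h₃ := Nat.count_succ (fun y ↦ ¬ A y) x
    rw [if_pos hA] at h₃
    have h₄ := Nat.count_monotone (fun y ↦ ¬ B y) (Nat.succ_le_of_lt hlt)
    have h₅ := Nat.count_succ A x
    rw [if_neg hA] at h₅
    have h₆ := h x
    simp only [Nat.succ_eq_add_one] at h₄
    omega

/-- A heap condition for matchings of predicates which have `j` solutions in each of `R`
consecutive blocks of length `2 * j`. -/
theorem isHeapPerm {k j R : ℕ} (hk : 2 ≤ k) (hj : 0 < j) (hσ : RankMatches A B σ)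
    (h : ∀ x, Nat.count B (x + 1) ≤ Nat.count A x)
    (hA : ∀ q, Nat.count A (2 * j * q) = j * min (q - 4) R)
    (hB : ∀ q, Nat.count B (2 * j * q) = j * min (q - 5) R) : IsHeapPerm k σ := by
  intro i hi
  set p : Fin n := ⟨((i : ℕ) - 1) / k, _⟩ with hp
  have hpi : 2 * (p : ℕ) + 1 ≤ i := by
    have h₁ : (p : ℕ) ≤ (i - 1) / 2 := Nat.div_le_div_left hk (by norm_num)
    omega
  have hlt : p < i := Fin.lt_def.2 (by omega)
  by_cases hAp : A p <;> by_cases hAi : A i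
  · exact hσ.lt_of_pos hAp hAi hlt
  · set q := (p : ℕ) / (2 * j)
    set r := (i : ℕ) / (2 * j)
    have hm : 0 < 2 * j := by omega
    have hq₁ : 2 * j * q ≤ p := Nat.mul_div_le _ _
    have hq₂ : (p : ℕ) < 2 * j * (q + 1) := Nat.lt_mul_div_succ _ hm
    have hr₁ : 2 * j * r ≤ i := Nat.mul_div_le _ _
    have hq : 4 ≤ q := by
      have h₀ : ¬ (p : ℕ) < 2 * j * 4 := fun hlt' ↦
        Nat.count_iff_forall_not.1 (by rw [hA]; simp) p hlt' hAp
      exact (Nat.le_div_iff_mul_le hm).2 (by rw [mul_comm]; omega)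
    have hqr : 2 * q ≤ r := (Nat.le_div_iff_mul_le hm).2 (by nlinarith)
    have hy : (σ p : ℕ) < 2 * j * (q + 2) := by
      obtain ⟨-, -, hc⟩ | hc := hσ p
      · refine Nat.lt_of_count_lt_count (p := B) ?_
        rw [← hc, hB]
        have := Nat.count_strict_mono hAp hq₂
        rwa [hA] at this
      · exact absurd hAp hc.1
    have hz : 2 * j * (r - 1) ≤ σ i := by
      obtain hc | ⟨-, hBi, hc⟩ := hσ i
      · exact absurd hc.1 hAi
      · by_contra! hlt'
        have h₁ := Nat.count_strict_mono (p := fun y ↦ ¬ B y) hBi hlt'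
        have h₂ := Nat.count_monotone (fun y ↦ ¬ A y) hr₁
        have h₃ := Nat.count_add_count_not A (2 * j * r)
        have h₄ := Nat.count_add_count_not B (2 * j * (r - 1))
        rw [hA] at h₃
        rw [hB] at h₄
        have h₅ : min (r - 4) R ≤ min (r - 1 - 5) R + 2 := by omega
        have h₆ : j * min (r - 4) R ≤ j * (min (r - 1 - 5) R + 2) := Nat.mul_le_mul_left _ h₅
        have h₇ : 2 * j * r = 2 * j * (r - 1) + 2 * j := by
          rw [← mul_add_one]; congr 1; omega
        rw [mul_add] at h₆
        omega
    have : 2 * j * (q + 2) ≤ 2 * j * (r - 1) := Nat.mul_le_mul_left _ (by omega)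
    exact Fin.lt_def.2 (by omega)
  · have h₁ := (hσ.lt_apply_iff h p).not.2 hAp
    have h₂ := (hσ.lt_apply_iff h i).2 hAi
    exact (not_lt.1 h₁).trans_lt (hlt.trans h₂)
  · exact hσ.lt_of_neg hAp hAi hlt

end RankMatches

/-- The natural numbers whose `q`-th block of length `m` is prescribed by `f q`. -/
def blockPred (m : ℕ) (f : ℕ → Finset ℕ) (x : ℕ) : Prop := x % m ∈ f (x / m)

instance (m : ℕ) (f : ℕ → Finset ℕ) : DecidablePred (blockPred m f) :=
  fun x ↦ inferInstanceAs (Decidable (x % m ∈ f (x / m)))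

theorem blockPred_mul_add {m q r : ℕ} (f : ℕ → Finset ℕ) (hr : r < m) :
    blockPred m f (m * q + r) ↔ r ∈ f q := by
  rw [blockPred, Nat.mul_add_mod, Nat.mod_eq_of_lt hr, Nat.mul_add_div (by omega),
    Nat.div_eq_of_lt hr, add_zero]

theorem count_blockPred {m : ℕ} {f : ℕ → Finset ℕ} (hf : ∀ q, f q ⊆ Finset.range m) (q : ℕ) :
    Nat.count (blockPred m f) (m * q) = ∑ i ∈ Finset.range q, (f i).card := by
  induction q with
  | zero => simp
  | succ q ih =>
    rw [mul_add_one, Nat.count_add, ih, Finset.sum_range_succ, Nat.count_eq_card_filter_range]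
    congr 2
    ext r
    simp only [Finset.mem_filter, Finset.mem_range]
    constructor
    · rintro ⟨hr, h⟩
      exact (blockPred_mul_add f hr).1 h
    · intro h
      have hr := Finset.mem_range.1 (hf q h)
      exact ⟨hr, (blockPred_mul_add f hr).2 h⟩

/-- Place the sets `F 0, …, F (R - 1)` in the blocks `s, …, s + R - 1`. -/
def shiftBlocks {R j m : ℕ} (s : ℕ) (F : Fin R → Finset.powersetCard j (Finset.range m)) (q : ℕ) :
    Finset ℕ :=
  if h : s ≤ q ∧ q - s < R then (F ⟨q - s, h.2⟩ : Finset ℕ) else ∅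

section shiftBlocks

variable {R j m : ℕ} (s : ℕ) (F : Fin R → Finset.powersetCard j (Finset.range m))

theorem shiftBlocks_subset (q : ℕ) : shiftBlocks s F q ⊆ Finset.range m := by
  unfold shiftBlocks
  split_ifs with h
  · exact (Finset.mem_powersetCard.1 (F _).2).1
  · simp

theorem shiftBlocks_add (q : Fin R) : shiftBlocks s F (s + q) = F q := by
  simp [shiftBlocks]

theorem count_shiftBlocks (q : ℕ) :
    Nat.count (blockPred m (shiftBlocks s F)) (m * q) = j * min (q - s) R := by
  rw [count_blockPred (shiftBlocks_subset s F)]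
  induction q with
  | zero => simp
  | succ q ih =>
    rw [Finset.sum_range_succ, ih]
    unfold shiftBlocks
    split_ifs with h
    · rw [(Finset.mem_powersetCard.1 (F _).2).2, ← mul_add_one]
      congr 1
      omega
    · rw [Finset.card_empty, add_zero]
      congr 1
      omega

theorem shiftBlocks_injective {n : ℕ} (hn : m * (s + R) ≤ n)
    {F G : Fin R → Finset.powersetCard j (Finset.range m)}
    (h : ∀ x < n, blockPred m (shiftBlocks s F) x ↔ blockPred m (shiftBlocks s G) x) : F = G := by
  funext q
  refine Subtype.ext (Finset.ext fun r ↦ ?_)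
  by_cases hr : r < m
  · have hlt : m * (s + q) + r < n := by
      have : m * (s + q + 1) ≤ m * (s + R) := Nat.mul_le_mul_left _ (by omega)
      rw [mul_add_one] at this
      omega
    have := h _ hlt
    rwa [blockPred_mul_add _ hr, blockPred_mul_add _ hr, shiftBlocks_add, shiftBlocks_add] at this
  · have hmem (K : Fin R → Finset.powersetCard j (Finset.range m)) : r ∉ (K q : Finset ℕ) :=
      fun hK ↦ hr (Finset.mem_range.1 ((Finset.mem_powersetCard.1 (K q).2).1 hK))
    exact iff_of_false (hmem F) (hmem G)

end shiftBlocks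

theorem count_shiftBlocks_succ_le {R j m : ℕ} (hm : 0 < m)
    (F G : Fin R → Finset.powersetCard j (Finset.range m)) (s x : ℕ) :
    Nat.count (blockPred m (shiftBlocks (s + 1) G)) (x + 1) ≤
      Nat.count (blockPred m (shiftBlocks s F)) x := by
  calc _ ≤ Nat.count (blockPred m (shiftBlocks (s + 1) G)) (m * (x / m + 1)) :=
        Nat.count_monotone _ (Nat.succ_le_of_lt (Nat.lt_mul_div_succ _ hm))
    _ = Nat.count (blockPred m (shiftBlocks s F)) (m * (x / m)) := by
        rw [count_shiftBlocks, count_shiftBlocks, Nat.add_sub_add_right]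
    _ ≤ _ := Nat.count_monotone _ (Nat.mul_div_le _ _)

theorem centralBinom_pow_le_heapCount {k j R n : ℕ} (hk : 2 ≤ k) (hj : 0 < j)
    (hn : 2 * j * (5 + R) ≤ n) :
    j.centralBinom ^ (2 * R) ≤ heapCount k {(⟨3, pat321⟩ : Σ m, Equiv.Perm (Fin m))} n := by
  let T := Fin R → Finset.powersetCard j (Finset.range (2 * j))
  have hcard : Nat.card (T × T) = j.centralBinom ^ (2 * R) := by
    have hT : Nat.card T = j.centralBinom ^ R := by
      rw [Nat.card_eq_fintype_card, Fintype.card_fun, Fintype.card_coe, Finset.card_powersetCard,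
        Finset.card_range, Fintype.card_fin, Nat.centralBinom]
    rw [Nat.card_prod, hT, two_mul, pow_add]
  have hm : 0 < 2 * j := by omega
  have hle (F G : T) := count_shiftBlocks_succ_le hm F G 4
  have hcount (F G : T) : Nat.count (blockPred (2 * j) (shiftBlocks 4 F)) n =
      Nat.count (blockPred (2 * j) (shiftBlocks 5 G)) n := by
    have h₁ (s : ℕ) (hs : s ≤ 5) (K : T) :
        Nat.count (blockPred (2 * j) (shiftBlocks s K)) n = j * R := by
      apply le_antisymm
      · refine (Nat.count_monotone _ (Nat.lt_mul_div_succ n hm).le).trans ?_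
        rw [count_shiftBlocks]
        exact Nat.mul_le_mul_left _ (min_le_right _ _)
      · refine le_trans ?_ (Nat.count_monotone _ hn)
        rw [count_shiftBlocks]
        exact Nat.mul_le_mul_left _ (by omega)
    rw [h₁ 4 (by norm_num), h₁ 5 le_rfl]
  choose σ hσ using fun P : T × T ↦ exists_rankMatches (hcount P.1 P.2)
  rw [← hcard]
  refine Nat.card_le_card_of_injective
    (fun P ↦ ⟨σ P, (hσ P).isHeapPerm hk hj (hle P.1 P.2) (count_shiftBlocks 4 P.1)
      (count_shiftBlocks 5 P.2), (hσ P).avoidsAll_pat321⟩) ?_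
  rintro ⟨F, G⟩ ⟨F', G'⟩ hFG
  have hFG : σ (F, G) = σ (F', G') := congrArg Subtype.val hFG
  have hA (x : Fin n) :
      blockPred (2 * j) (shiftBlocks 4 F) x ↔ blockPred (2 * j) (shiftBlocks 4 F') x := by
    rw [← (hσ (F, G)).lt_apply_iff (hle F G), ← (hσ (F', G')).lt_apply_iff (hle F' G'), hFG]
  have hB (y : Fin n) :
      blockPred (2 * j) (shiftBlocks 5 G) y ↔ blockPred (2 * j) (shiftBlocks 5 G') y := by
    obtain ⟨x, rfl⟩ := (σ (F, G)).surjective y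
    rw [(hσ (F, G)).apply_iff, hA, hFG, (hσ (F', G')).apply_iff]
  rw [shiftBlocks_injective 4 (le_trans (Nat.mul_le_mul_left _ (by omega)) hn)
      fun x hx ↦ hA ⟨x, hx⟩, shiftBlocks_injective 5 hn fun x hx ↦ hB ⟨x, hx⟩]

theorem four_pow_le_mul_heapCount {k j n : ℕ} (hk : 2 ≤ k) (hj : 0 < j) (hn : 10 * j ≤ n) :
    (4 : ℝ) ^ n ≤ 4 ^ (12 * j) * (2 * j : ℝ) ^ ((n : ℝ) * (2 / (2 * j))) *
      heapCount k {(⟨3, pat321⟩ : Σ m, Equiv.Perm (Fin m))} n := by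
  set N := heapCount k {(⟨3, pat321⟩ : Σ m, Equiv.Perm (Fin m))} n
  have hm : 0 < 2 * j := by omega
  obtain ⟨R, hR⟩ : ∃ R, n / (2 * j) = 5 + R :=
    Nat.exists_eq_add_of_le ((Nat.le_div_iff_mul_le hm).2 (by omega))
  have h₁ : 2 * j * (5 + R) ≤ n := hR ▸ Nat.mul_div_le _ _
  have h₂ : n ≤ 12 * j + j * (2 * R) := by
    have := Nat.lt_mul_div_succ n hm
    rw [hR] at this
    nlinarith
  have h₃ : (j.centralBinom : ℝ) ^ (2 * R) ≤ N := by
    exact_mod_cast centralBinom_pow_le_heapCount hk hj h₁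
  have h₄ : (4 : ℝ) ^ j ≤ 2 * j * j.centralBinom := by
    exact_mod_cast Nat.four_pow_le_two_mul_self_mul_centralBinom j hj
  have hj' : (1 : ℝ) ≤ j := by exact_mod_cast hj
  have h₅ : (2 * j : ℝ) ^ (2 * R) ≤ (2 * j : ℝ) ^ ((n : ℝ) * (2 / (2 * j))) := by
    rw [← Real.rpow_natCast]
    refine Real.rpow_le_rpow_of_exponent_le (by linarith) ?_
    have : (2 * j * (5 + R) : ℝ) ≤ n := by exact_mod_cast h₁
    push_cast
    rw [mul_div_assoc', le_div_iff₀ (by linarith)]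
    nlinarith
  calc (4 : ℝ) ^ n ≤ 4 ^ (12 * j + j * (2 * R)) := pow_le_pow_right₀ (by norm_num) h₂
    _ = 4 ^ (12 * j) * (4 ^ j) ^ (2 * R) := by rw [pow_add, pow_mul 4 j]
    _ ≤ 4 ^ (12 * j) * (2 * j * j.centralBinom) ^ (2 * R) := by gcongr
    _ = 4 ^ (12 * j) * (2 * j) ^ (2 * R) * j.centralBinom ^ (2 * R) := by
        rw [mul_pow, mul_assoc]
    _ ≤ _ := by gcongr

theorem tendsto_heapCount_rpow {k : ℕ} (hk : 2 ≤ k) :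
    Tendsto (fun n : ℕ ↦
      (heapCount k {(⟨3, pat321⟩ : Σ m, Equiv.Perm (Fin m))} n : ℝ) ^ (1 / (n : ℝ)))
      atTop (𝓝 4) := by
  refine tendsto_order.2 ⟨fun c hc ↦ ?_, fun c hc ↦ ?_⟩
  · have hlim : Tendsto (fun j : ℕ ↦ c * (2 * j : ℝ) ^ (2 / (2 * j : ℝ))) atTop (𝓝 (c * 1)) := by
      refine Tendsto.const_mul c ?_
      have := (tendsto_rpow_div_mul_add 2 1 0 (by norm_num)).comp
        ((tendsto_natCast_atTop_atTop (R := ℝ)).const_mul_atTop (zero_lt_two' ℝ))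
      simpa [Function.comp_def] using this
    rw [mul_one] at hlim
    obtain ⟨j, hj, hj₀⟩ := ((hlim.eventually_lt_const hc).and (eventually_gt_atTop 0)).exists
    have hlim' : Tendsto (fun n : ℕ ↦ ((4 : ℝ) ^ (12 * j)) ^ (1 / (n : ℝ)) *
        (c * (2 * j : ℝ) ^ (2 / (2 * j : ℝ)))) atTop
        (𝓝 (1 * (c * (2 * j : ℝ) ^ (2 / (2 * j : ℝ))))) := by
      refine Tendsto.mul_const _ ?_
      have := (tendsto_const_nhds (x := (4 : ℝ) ^ (12 * j))).rpow
        tendsto_one_div_atTop_nhds_zero_nat (Or.inl (by positivity))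
      rwa [Real.rpow_zero] at this
    rw [one_mul] at hlim'
    filter_upwards [hlim'.eventually_lt_const hj, eventually_ge_atTop (10 * j)] with n hn hnj
    have hn₀ : (n : ℝ) ≠ 0 := by
      have : n ≠ 0 := by omega
      exact_mod_cast this
    have h := Real.rpow_le_rpow (by positivity) (four_pow_le_mul_heapCount hk hj₀ hnj)
      (show 0 ≤ 1 / (n : ℝ) by positivity)
    rw [Real.mul_rpow (by positivity) (by positivity), Real.mul_rpow (by positivity) (by positivity),
      ← Real.rpow_natCast, ← Real.rpow_mul (by norm_num), ← Real.rpow_mul (by positivity),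
      mul_one_div_cancel hn₀, Real.rpow_one, mul_right_comm (n : ℝ), mul_one_div_cancel hn₀,
      one_mul] at h
    have h' := hn.trans_le h
    rw [← mul_assoc, mul_right_comm] at h'
    exact lt_of_mul_lt_mul_left h' (by positivity)
  · filter_upwards [eventually_gt_atTop 0] with n hn
    refine lt_of_le_of_lt ?_ hc
    have hn₀ : (n : ℝ) ≠ 0 := by exact_mod_cast hn.ne'
    have h : (heapCount k {(⟨3, pat321⟩ : Σ m, Equiv.Perm (Fin m))} n : ℝ) ≤ 4 ^ n := by
      exact_mod_cast heapCount_pat321_le k n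
    refine (Real.rpow_le_rpow (by positivity) h (by positivity)).trans_eq ?_
    rw [← Real.rpow_natCast, ← Real.rpow_mul (by norm_num), mul_one_div_cancel hn₀, Real.rpow_one]

/-- **Corollary 2.** For every `k ≥ 2`, `lim_{n→∞} |H_n^k(321)|^{1/n} = 4`. -/
theorem heap_growth_321 (k : ℕ) (hk : 2 ≤ k) :
    Tendsto
      (fun n : ℕ =>
        (heapCount k {(⟨3, pat321⟩ : Σ m, Equiv.Perm (Fin m))} n : ℝ≥0∞) ^ (1 / (n : ℝ)))
      atTop (𝓝 4) := by
  have h := ENNReal.tendsto_ofReal (tendsto_heapCount_rpow hk)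
  rw [ENNReal.ofReal_ofNat] at h
  refine h.congr fun n ↦ ?_
  rw [← ENNReal.ofReal_rpow_of_nonneg (by positivity) (by positivity), ENNReal.ofReal_natCast]
end

section
/- For all integers t ≥ 1, the polynomial identity (1−q)(1−q²)·N_{3,t}(1243)(q) = q^{3(t²−t+1)}(1 − q^{2t−1} − 2q^{2t} + q^{3t−1} + q^{3t}) holds in ℤ[q]. -/
open Polynomial

/-- The pattern `1243` (0-indexed). -/
def pat1243 : Equiv.Perm (Fin 4) := ⟨![0, 1, 3, 2], ![0, 1, 3, 2], by decide, by decide⟩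

/-- The pattern `2143` (0-indexed). -/
def pat2143 : Equiv.Perm (Fin 4) := ⟨![1, 0, 3, 2], ![1, 0, 3, 2], by decide, by decide⟩

/-- `w ∈ S_{st}` (a word recorded as a permutation of `Fin (s*t)`, positions and labels both
0-indexed, 0-indexed label `a` standing for the poset label `a+1`) encodes a linear extension
of the rectangular poset `N_{s,t}`: for every label `a ∈ [st]`, if `t ∤ a` then `a` appears
before `a+1`, and if `a > t` then `a` appears before `a−t`.  ("`a` appears before `b`" means
`w.symm a < w.symm b`.) -/
def IsLinExtN (s t : ℕ) (w : Equiv.Perm (Fin (s * t))) : Prop :=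
  (∀ a b : Fin (s * t), (b : ℕ) = (a : ℕ) + 1 → ¬ (t ∣ ((a : ℕ) + 1)) →
      w.symm a < w.symm b) ∧
  (∀ a b : Fin (s * t), (b : ℕ) + t = (a : ℕ) → w.symm a < w.symm b)

/-- The number of inversions of `w`. -/
def invCount {n : ℕ} (w : Equiv.Perm (Fin n)) : ℕ :=
  (Finset.univ.filter fun p : Fin n × Fin n => p.1 < p.2 ∧ w p.2 < w p.1).card

open Classical in
/-- The polynomial `N_{s,t}(τ)(q) = Σ_{w ∈ N_{s,t}(τ)} q^{inv(w)}`. -/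
noncomputable def NPoly (s t : ℕ) {m : ℕ} (τ : Equiv.Perm (Fin m)) : Polynomial ℤ :=
  ∑ w ∈ Finset.univ.filter
      (fun w : Equiv.Perm (Fin (s * t)) => IsLinExtN s t w ∧ ¬ PermContains w τ),
    (X : Polynomial ℤ) ^ invCount w


section PatternOccurrences

lemma permContains_pat1243_iff {n : ℕ} (w : Equiv.Perm (Fin n)) :
    PermContains w pat1243 ↔ ∃ a b c d : Fin n, a < b ∧ b < d ∧ d < c ∧
      w.symm a < w.symm b ∧ w.symm b < w.symm c ∧ w.symm c < w.symm d := by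
  constructor
  · rintro ⟨f, hf, h⟩
    refine ⟨w (f 0), w (f 1), w (f 2), w (f 3), (h 0 1).2 (by decide), (h 1 3).2 (by decide),
      (h 3 2).2 (by decide), ?_, ?_, ?_⟩ <;> simp only [Equiv.symm_apply_apply] <;>
      exact hf (by decide)
  · rintro ⟨a, b, c, d, hab, hbd, hdc, h1, h2, h3⟩
    refine ⟨![w.symm a, w.symm b, w.symm c, w.symm d], ?_, ?_⟩
    · rw [Fin.strictMono_iff_lt_succ]
      intro j
      fin_cases j
      · exact h1
      · exact h2
      · exact h3
    · intro j k
      fin_cases j <;> fin_cases k <;> simp [pat1243] <;> order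

end PatternOccurrences

/-- The order of appearance of labels in a `1243`-avoiding linear extension of `N_{3,t}`, where
`P a` is the position of the label `a`. -/
structure IsGoodOrder (t : ℕ) (P : Equiv.Perm (Fin (3 * t))) : Prop where
  row : ∀ a b : Fin (3 * t), a < b →
    ((b : ℕ) < t ∨ (t ≤ (a : ℕ) ∧ (b : ℕ) < 2 * t) ∨ 2 * t ≤ (a : ℕ)) → P a < P b
  top_mid : ∀ a b : Fin (3 * t), t < (a : ℕ) → (a : ℕ) < 2 * t → 2 * t ≤ (b : ℕ) → P b < P a
  rest_bot : ∀ a b : Fin (3 * t), 0 < (a : ℕ) → (a : ℕ) < t → t ≤ (b : ℕ) → P b < P a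
  mid_bot : ∀ a b : Fin (3 * t), (a : ℕ) = 0 → (b : ℕ) = t → P b < P a
  top_mid_zero : ∀ a b : Fin (3 * t), (a : ℕ) = t → (b : ℕ) = 2 * t → P b < P a

section Characterization

variable {t : ℕ}

lemma IsLinExtN.row {w : Equiv.Perm (Fin (3 * t))} (hw : IsLinExtN 3 t w)
    (a b : Fin (3 * t)) (hab : a < b)
    (h : (b : ℕ) < t ∨ (t ≤ (a : ℕ) ∧ (b : ℕ) < 2 * t) ∨ 2 * t ≤ (a : ℕ)) :
    w.symm a < w.symm b := by
  obtain ⟨d, hd⟩ : ∃ d, (b : ℕ) = a + d + 1 := ⟨b - a - 1, by omega⟩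
  induction d generalizing b with
  | zero =>
    refine hw.1 a b (by omega) ?_
    rintro ⟨k, hk⟩
    have hb := b.2
    rcases h with h | h | h
    · rcases k with _ | k
      · simp at hk
      · nlinarith
    · rcases k with _ | _ | k
      · simp at hk
      · omega
      · nlinarith
    · rcases k with _ | _ | _ | k
      · simp at hk
      · omega
      · omega
      · nlinarith
  | succ d ih =>
    have hb := b.2
    let c : Fin (3 * t) := ⟨a + d + 1, by omega⟩
    have hc : (c : ℕ) = a + d + 1 := rfl
    have h1 := ih c (by rw [Fin.lt_def]; omega) (by omega) hc
    refine h1.trans (hw.1 c b (by omega) ?_)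
    rintro ⟨k, hk⟩
    rcases h with h | h | h
    · rcases k with _ | k
      · simp at hk
      · nlinarith
    · rcases k with _ | _ | k
      · simp at hk
      · omega
      · nlinarith
    · rcases k with _ | _ | _ | k
      · simp at hk
      · omega
      · omega
      · nlinarith

lemma isGoodOrder_of_avoids {w : Equiv.Perm (Fin (3 * t))} (hw : IsLinExtN 3 t w)
    (hav : ¬ PermContains w pat1243) : IsGoodOrder t w.symm := by
  have row := hw.row
  have row' : ∀ a b : Fin (3 * t), a ≤ b →
      ((b : ℕ) < t ∨ (t ≤ (a : ℕ) ∧ (b : ℕ) < 2 * t) ∨ 2 * t ≤ (a : ℕ)) →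
      w.symm a ≤ w.symm b := by
    intro a b hab h
    rcases hab.eq_or_lt with rfl | hab
    · exact le_rfl
    · exact (row a b hab h).le
  rw [permContains_pat1243_iff] at hav
  refine ⟨row, ?_, ?_, ?_, ?_⟩
  · intro a b h1 h2 h3
    by_contra hlt
    have hb := b.2
    have hne : a ≠ b := by rintro rfl; omega
    have hab : w.symm a < w.symm b :=
      lt_of_le_of_ne (not_lt.1 hlt) (fun h => hne (w.symm.injective h))
    let z : Fin (3 * t) := ⟨a - 1, by omega⟩
    let y : Fin (3 * t) := ⟨2 * t - 1, by omega⟩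
    let x : Fin (3 * t) := ⟨3 * t - 1, by omega⟩
    have hby : w.symm b < w.symm y :=
      (row' b x (by rw [Fin.le_def]; simp only [x]; omega) (by omega)).trans_lt
        (hw.2 x y (by simp only [x, y]; omega))
    have hay : a < y := by
      by_contra h
      have := row' y a (not_lt.1 h) (by simp only [y]; omega)
      order
    exact hav ⟨z, a, b, y, by rw [Fin.lt_def]; simp only [z]; omega, hay,
      by rw [Fin.lt_def]; simp only [y]; omega,
      row z a (by rw [Fin.lt_def]; simp only [z]; omega) (by simp only [z]; omega), hab, hby⟩
  · intro a b h1 h2 h3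
    by_contra hlt
    have hb := b.2
    have hne : a ≠ b := by rintro rfl; omega
    have hab : w.symm a < w.symm b :=
      lt_of_le_of_ne (not_lt.1 hlt) (fun h => hne (w.symm.injective h))
    let z : Fin (3 * t) := ⟨a - 1, by omega⟩
    let v : Fin (3 * t) := ⟨t - 1, by omega⟩
    let y : Fin (3 * t) := ⟨2 * t - 1, by omega⟩
    let x : Fin (3 * t) := ⟨3 * t - 1, by omega⟩
    have hyv : w.symm y < w.symm v := hw.2 y v (by simp only [y, v]; omega)
    have hxy : w.symm x < w.symm y := hw.2 x y (by simp only [x, y]; omega)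
    have hbv : w.symm b < w.symm v := by
      by_cases hb2 : (b : ℕ) < 2 * t
      · exact (row' b y (by rw [Fin.le_def]; simp only [y]; omega)
          (by simp only [y]; omega)).trans_lt hyv
      · exact (row' b x (by rw [Fin.le_def]; simp only [x]; omega)
          (by omega)).trans_lt (hxy.trans hyv)
    have hav' : a < v := by
      by_contra h
      have := row' v a (not_lt.1 h) (by omega)
      order
    exact hav ⟨z, a, b, v, by rw [Fin.lt_def]; simp only [z]; omega, hav',
      by rw [Fin.lt_def]; simp only [v]; omega,
      row z a (by rw [Fin.lt_def]; simp only [z]; omega) (by omega), hab, hbv⟩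
  · intro a b ha hb
    exact hw.2 b a (by omega)
  · intro a b ha hb
    exact hw.2 b a (by omega)

lemma IsGoodOrder.isLinExtN {w : Equiv.Perm (Fin (3 * t))} (h : IsGoodOrder t w.symm) :
    IsLinExtN 3 t w := by
  constructor
  · intro a b hab hdvd
    refine h.row a b (by rw [Fin.lt_def]; omega) ?_
    by_contra hcon
    have hb := b.2
    apply hdvd
    rcases (show (a : ℕ) + 1 = t ∨ (a : ℕ) + 1 = 2 * t by omega) with h' | h'
    · exact ⟨1, by omega⟩
    · exact ⟨2, by omega⟩
  · intro a b hab
    have ha := a.2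
    by_cases h1 : (a : ℕ) < 2 * t
    · rcases Nat.eq_zero_or_pos (b : ℕ) with h0 | h0
      · exact h.mid_bot b a h0 (by omega)
      · exact h.rest_bot b a h0 (by omega) (by omega)
    · rcases (show (b : ℕ) = t ∨ t < (b : ℕ) by omega) with h0 | h0
      · exact h.top_mid_zero b a h0 (by omega)
      · exact h.top_mid b a h0 (by omega) (by omega)

lemma IsGoodOrder.avoids {w : Equiv.Perm (Fin (3 * t))} (h : IsGoodOrder t w.symm) :
    ¬ PermContains w pat1243 := by
  rw [permContains_pat1243_iff]
  rintro ⟨a, b, c, d, hab, hbd, hdc, h1, h2, h3⟩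
  have hd := d.2
  have hc := c.2
  have hrow := fun hh => lt_asymm h3 (h.row d c hdc hh)
  have hbot := fun ha1 ha2 ha3 => lt_asymm h2 (h.rest_bot b c ha1 ha2 ha3)
  have hmid := fun ha1 ha2 ha3 => lt_asymm h2 (h.top_mid b c ha1 ha2 ha3)
  rw [Fin.lt_def] at hab hbd hdc
  have hbt : (b : ℕ) = t := by
    by_contra hne
    by_cases c1 : (c : ℕ) < t
    · exact hrow (by omega)
    by_cases b1 : (b : ℕ) < t
    · exact hbot (by omega) b1 (by omega)
    by_cases c2 : (c : ℕ) < 2 * t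
    · exact hrow (by omega)
    by_cases b2 : (b : ℕ) < 2 * t
    · exact hmid (by omega) (by omega) (by omega)
    · exact hrow (by omega)
  rcases Nat.eq_zero_or_pos (a : ℕ) with h0 | h0
  · exact lt_asymm h1 (h.mid_bot a b h0 hbt)
  · exact lt_asymm h1 (h.rest_bot a b h0 (by omega) (by omega))

lemma isLinExtN_and_avoids_iff {w : Equiv.Perm (Fin (3 * t))} :
    IsLinExtN 3 t w ∧ ¬ PermContains w pat1243 ↔ IsGoodOrder t w.symm :=
  ⟨fun h => isGoodOrder_of_avoids h.1 h.2, fun h => ⟨h.isLinExtN, h.avoids⟩⟩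

end Characterization

section Counting

lemma Equiv.Perm.card_filter_lt {n : ℕ} (P : Equiv.Perm (Fin n)) (a : Fin n) :
    (Finset.univ.filter fun b => P b < P a).card = (P a : ℕ) := by
  rw [← Fin.card_Iio (P a)]
  refine Finset.card_bij (fun b _ => P b) ?_ ?_ ?_
  · simp
  · intro x _ y _ h
    exact P.injective h
  · intro y hy
    exact ⟨P.symm y, by simpa using hy, by simp⟩

lemma Fin.card_filter_le_and_lt {n k m : ℕ} (h : m ≤ n) :
    (Finset.univ.filter fun b : Fin n => k ≤ (b : ℕ) ∧ (b : ℕ) < m).card = m - k := by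
  rw [← Nat.card_Ico]
  refine Finset.card_bij (fun b _ => (b : ℕ)) ?_ ?_ ?_
  · simp
  · intro x _ y _ h
    exact Fin.ext h
  · intro y hy
    rw [Finset.mem_Ico] at hy
    exact ⟨⟨y, by omega⟩, by simpa using hy, rfl⟩

lemma invCount_eq_sum {n : ℕ} (w : Equiv.Perm (Fin n)) :
    invCount w = ∑ a : Fin n,
      (Finset.univ.filter fun b => a < b ∧ w.symm b < w.symm a).card := by
  simp only [invCount, Finset.card_filter, Fintype.sum_prod_type]
  rw [Finset.sum_comm, ← Equiv.sum_comp w.symm]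
  refine Finset.sum_congr rfl fun a _ => ?_
  rw [← Equiv.sum_comp w.symm]
  simp [and_comm]

variable {t : ℕ} {P : Equiv.Perm (Fin (3 * t))}


lemma IsGoodOrder.row_le (h : IsGoodOrder t P) {a b : Fin (3 * t)} (hab : a ≤ b)
    (hr : (b : ℕ) < t ∨ (t ≤ (a : ℕ) ∧ (b : ℕ) < 2 * t) ∨ 2 * t ≤ (a : ℕ)) : P a ≤ P b := by
  rcases hab.eq_or_lt with rfl | hab
  · exact le_rfl
  · exact (h.row a b hab hr).le

lemma IsGoodOrder.two_mul_le_of_lt_mid (h : IsGoodOrder t P) {m b : Fin (3 * t)}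
    (hm : (m : ℕ) = t) (hb : P b < P m) : 2 * t ≤ (b : ℕ) := by
  by_contra hb2
  refine hb.not_ge ?_
  by_cases hb1 : (b : ℕ) < t
  · rcases Nat.eq_zero_or_pos (b : ℕ) with h0 | h0
    · exact (h.mid_bot b m h0 hm).le
    · exact (h.rest_bot b m h0 hb1 hm.ge).le
  · exact h.row_le (by rw [Fin.le_def]; omega) (by omega)

lemma IsGoodOrder.le_of_lt_zero (h : IsGoodOrder t P) {z b : Fin (3 * t)}
    (hz : (z : ℕ) = 0) (hb : P b < P z) : t ≤ (b : ℕ) := by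
  by_contra hb2
  exact hb.not_ge (h.row_le (by rw [Fin.le_def]; omega) (by omega))

lemma IsGoodOrder.mid_pos (h : IsGoodOrder t P) {m : Fin (3 * t)} (hm : (m : ℕ) = t) :
    1 ≤ (P m : ℕ) := by
  have := m.2
  have := h.top_mid_zero m ⟨2 * t, by omega⟩ hm rfl
  rw [Fin.lt_def] at this
  omega

lemma IsGoodOrder.mid_le (h : IsGoodOrder t P) {m : Fin (3 * t)} (hm : (m : ℕ) = t) :
    (P m : ℕ) ≤ t := by
  have hsub : (Finset.univ.filter fun b => P b < P m) ⊆
      Finset.univ.filter fun b : Fin (3 * t) => 2 * t ≤ (b : ℕ) ∧ (b : ℕ) < 3 * t := by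
    intro b
    simp only [Finset.mem_filter, Finset.mem_univ, true_and]
    exact fun hb => ⟨h.two_mul_le_of_lt_mid hm hb, b.2⟩
  have := Finset.card_le_card hsub
  rw [P.card_filter_lt, Fin.card_filter_le_and_lt le_rfl] at this
  omega

lemma IsGoodOrder.zero_le (h : IsGoodOrder t P) {z : Fin (3 * t)} (hz : (z : ℕ) = 0) :
    (P z : ℕ) ≤ 2 * t := by
  have hsub : (Finset.univ.filter fun b => P b < P z) ⊆
      Finset.univ.filter fun b : Fin (3 * t) => t ≤ (b : ℕ) ∧ (b : ℕ) < 3 * t := by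
    intro b
    simp only [Finset.mem_filter, Finset.mem_univ, true_and]
    exact fun hb => ⟨h.le_of_lt_zero hz hb, b.2⟩
  have := Finset.card_le_card hsub
  rw [P.card_filter_lt, Fin.card_filter_le_and_lt le_rfl] at this
  omega

lemma IsGoodOrder.top_lt_mid_iff (h : IsGoodOrder t P) {m x : Fin (3 * t)} (hm : (m : ℕ) = t)
    (hx : 2 * t ≤ (x : ℕ)) : P x < P m ↔ (x : ℕ) < 2 * t + P m := by
  have hx3 := x.2
  constructor
  · intro hlt
    have hsub : (Finset.univ.filter fun b : Fin (3 * t) => 2 * t ≤ (b : ℕ) ∧ (b : ℕ) < x + 1) ⊆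
        Finset.univ.filter fun b => P b < P m := by
      intro b
      simp only [Finset.mem_filter, Finset.mem_univ, true_and]
      rintro ⟨h1, h2⟩
      exact (h.row_le (by rw [Fin.le_def]; omega) (by omega)).trans_lt hlt
    have := Finset.card_le_card hsub
    rw [P.card_filter_lt, Fin.card_filter_le_and_lt (by omega)] at this
    omega
  · intro hlt
    by_contra hge
    have hsub : (Finset.univ.filter fun b => P b < P m) ⊆
        Finset.univ.filter fun b : Fin (3 * t) => 2 * t ≤ (b : ℕ) ∧ (b : ℕ) < x := by
      intro b
      simp only [Finset.mem_filter, Finset.mem_univ, true_and]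
      intro hb
      refine ⟨h.two_mul_le_of_lt_mid hm hb, ?_⟩
      by_contra hbx
      have : P x ≤ P b := h.row_le (by rw [Fin.le_def]; omega) (by omega)
      order
    have := Finset.card_le_card hsub
    rw [P.card_filter_lt, Fin.card_filter_le_and_lt (by omega)] at this
    omega

lemma IsGoodOrder.top_lt_zero_iff (h : IsGoodOrder t P) {z x : Fin (3 * t)} (hz : (z : ℕ) = 0)
    (hx : 2 * t ≤ (x : ℕ)) : P x < P z ↔ (x : ℕ) + 1 < 2 * t + P z := by
  have hx3 := x.2
  let m : Fin (3 * t) := ⟨t, by omega⟩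
  have hmz := h.mid_bot z m hz rfl
  constructor
  · intro hlt
    have hsub : insert m
        (Finset.univ.filter fun b : Fin (3 * t) => 2 * t ≤ (b : ℕ) ∧ (b : ℕ) < x + 1) ⊆
        Finset.univ.filter fun b => P b < P z := by
      intro b
      simp only [Finset.mem_insert, Finset.mem_filter, Finset.mem_univ, true_and]
      rintro (rfl | ⟨h1, h2⟩)
      · exact hmz
      · exact (h.row_le (by rw [Fin.le_def]; omega) (by omega)).trans_lt hlt
    have := Finset.card_le_card hsub
    rw [P.card_filter_lt, Finset.card_insert_of_notMem (by simp [m]; omega),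
      Fin.card_filter_le_and_lt (by omega)] at this
    omega
  · intro hlt
    by_contra hge
    have hsub : (Finset.univ.filter fun b => P b < P z) ⊆ insert m
        (Finset.univ.filter fun b : Fin (3 * t) => 2 * t ≤ (b : ℕ) ∧ (b : ℕ) < x) := by
      intro b
      simp only [Finset.mem_insert, Finset.mem_filter, Finset.mem_univ, true_and, Fin.ext_iff]
      intro hb
      have h1 := h.le_of_lt_zero hz hb
      by_contra hcon
      have : P x ≤ P b := by
        by_cases hb2 : (b : ℕ) < 2 * t
        · exact (h.top_mid b x (by simp only [m] at hcon; omega) hb2 hx).le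
        · exact h.row_le (by rw [Fin.le_def]; omega) (by omega)
      order
    have := (Finset.card_le_card hsub).trans (Finset.card_insert_le _ _)
    rw [P.card_filter_lt, Fin.card_filter_le_and_lt (by omega)] at this
    omega

lemma IsGoodOrder.mid_lt_zero_iff (h : IsGoodOrder t P) {z x : Fin (3 * t)} (hz : (z : ℕ) = 0)
    (hx : t < (x : ℕ)) (hx' : (x : ℕ) < 2 * t) : P x < P z ↔ (x : ℕ) < P z := by
  constructor
  · intro hlt
    have hsub : (Finset.univ.filter fun b : Fin (3 * t) => t ≤ (b : ℕ) ∧ (b : ℕ) < x + 1) ∪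
        (Finset.univ.filter fun b : Fin (3 * t) => 2 * t ≤ (b : ℕ) ∧ (b : ℕ) < 3 * t) ⊆
        Finset.univ.filter fun b => P b < P z := by
      intro b
      simp only [Finset.mem_union, Finset.mem_filter, Finset.mem_univ, true_and]
      rintro (⟨h1, h2⟩ | ⟨h1, h2⟩)
      · exact (h.row_le (by rw [Fin.le_def]; omega) (by omega)).trans_lt hlt
      · exact (h.top_mid x b hx hx' h1).trans hlt
    have := Finset.card_le_card hsub
    rw [P.card_filter_lt, Finset.card_union_of_disjoint, Fin.card_filter_le_and_lt (by omega),
      Fin.card_filter_le_and_lt le_rfl] at this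
    · omega
    · rw [Finset.disjoint_filter]
      omega
  · intro hlt
    by_contra hge
    have hsub : (Finset.univ.filter fun b => P b < P z) ⊆
        (Finset.univ.filter fun b : Fin (3 * t) => t ≤ (b : ℕ) ∧ (b : ℕ) < x) ∪
        (Finset.univ.filter fun b : Fin (3 * t) => 2 * t ≤ (b : ℕ) ∧ (b : ℕ) < 3 * t) := by
      intro b
      simp only [Finset.mem_union, Finset.mem_filter, Finset.mem_univ, true_and]
      intro hb
      have h1 := h.le_of_lt_zero hz hb
      by_contra hcon
      have : P x ≤ P b := h.row_le (by rw [Fin.le_def]; omega) (by omega)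
      order
    have := (Finset.card_le_card hsub).trans (Finset.card_union_le _ _)
    rw [P.card_filter_lt, Fin.card_filter_le_and_lt (by omega),
      Fin.card_filter_le_and_lt le_rfl] at this
    omega

lemma IsGoodOrder.card_inversions (h : IsGoodOrder t P) {m z : Fin (3 * t)} (hm : (m : ℕ) = t)
    (hz : (z : ℕ) = 0) (a : Fin (3 * t)) :
    (Finset.univ.filter fun b => a < b ∧ P b < P a).card =
      if (a : ℕ) = 0 then (P z : ℕ) else if (a : ℕ) < t then 2 * t else
        if (a : ℕ) = t then (P m : ℕ) else if (a : ℕ) < 2 * t then t else 0 := by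
  have ha := a.2
  split_ifs with h1 h2 h3 h4
  · obtain rfl : a = z := Fin.ext (h1.trans hz.symm)
    rw [← P.card_filter_lt a]
    congr 1
    ext b
    simp only [Finset.mem_filter, Finset.mem_univ, true_and, and_iff_right_iff_imp]
    intro hb
    have := h.le_of_lt_zero hz hb
    rw [Fin.lt_def]
    omega
  · trans (Finset.univ.filter fun b : Fin (3 * t) => t ≤ (b : ℕ) ∧ (b : ℕ) < 3 * t).card
    · congr 1
      ext b
      simp only [Finset.mem_filter, Finset.mem_univ, true_and]
      constructor
      · rintro ⟨hab, hb⟩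
        refine ⟨?_, b.2⟩
        by_contra hbt
        exact lt_asymm hb (h.row a b hab (by omega))
      · rintro ⟨hb, -⟩
        exact ⟨by rw [Fin.lt_def]; omega, h.rest_bot a b (by omega) h2 hb⟩
    · rw [Fin.card_filter_le_and_lt le_rfl]
      omega
  · obtain rfl : a = m := Fin.ext (h3.trans hm.symm)
    rw [← P.card_filter_lt a]
    congr 1
    ext b
    simp only [Finset.mem_filter, Finset.mem_univ, true_and, and_iff_right_iff_imp]
    intro hb
    have := h.two_mul_le_of_lt_mid hm hb
    rw [Fin.lt_def]
    omega
  · trans (Finset.univ.filter fun b : Fin (3 * t) => 2 * t ≤ (b : ℕ) ∧ (b : ℕ) < 3 * t).card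
    · congr 1
      ext b
      simp only [Finset.mem_filter, Finset.mem_univ, true_and]
      constructor
      · rintro ⟨hab, hb⟩
        refine ⟨?_, b.2⟩
        by_contra hbt
        exact lt_asymm hb (h.row a b hab (by omega))
      · rintro ⟨hb, -⟩
        exact ⟨by rw [Fin.lt_def]; omega, h.top_mid a b (by omega) h4 hb⟩
    · rw [Fin.card_filter_le_and_lt le_rfl]
      omega
  · rw [Finset.card_eq_zero, Finset.filter_eq_empty_iff]
    rintro b - ⟨hab, hb⟩
    exact lt_asymm hb (h.row a b hab (by omega))

lemma IsGoodOrder.invCount_eq {w : Equiv.Perm (Fin (3 * t))} (h : IsGoodOrder t w.symm)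
    {m z : Fin (3 * t)} (hm : (m : ℕ) = t) (hz : (z : ℕ) = 0) :
    invCount w = 3 * t * (t - 1) + w.symm m + w.symm z := by
  rw [invCount_eq_sum, Finset.sum_congr rfl fun a _ => h.card_inversions hm hz a]
  obtain ⟨s, rfl⟩ : ∃ s, t = s + 1 := ⟨t - 1, by have := z.2; omega⟩
  generalize (w.symm m : ℕ) = i
  generalize (w.symm z : ℕ) = r
  rw [Fin.sum_univ_eq_sum_range (fun a => if a = 0 then r else if a < s + 1 then 2 * (s + 1) else
    if a = s + 1 then i else if a < 2 * (s + 1) then s + 1 else 0),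
    show 3 * (s + 1) = (1 + s) + ((1 + s) + (1 + s)) by ring]
  simp only [Finset.sum_range_add]
  have e1 : ∀ x ∈ Finset.range s, (if 1 + x = 0 then r else if 1 + x < s + 1 then 2 * (s + 1) else
      if 1 + x = s + 1 then i else if 1 + x < 2 * (s + 1) then s + 1 else 0) = 2 * (s + 1) := by
    intro x hx
    rw [Finset.mem_range] at hx
    rw [if_neg (by omega), if_pos (by omega)]
  have e2 : ∀ x ∈ Finset.range s, (if 1 + s + (1 + x) = 0 then r else
      if 1 + s + (1 + x) < s + 1 then 2 * (s + 1) else if 1 + s + (1 + x) = s + 1 then i else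
      if 1 + s + (1 + x) < 2 * (s + 1) then s + 1 else 0) = s + 1 := by
    intro x hx
    rw [Finset.mem_range] at hx
    rw [if_neg (by omega), if_neg (by omega), if_neg (by omega), if_pos (by omega)]
  have e3 : ∀ x, (if 1 + s + (1 + s + x) = 0 then r else
      if 1 + s + (1 + s + x) < s + 1 then 2 * (s + 1) else if 1 + s + (1 + s + x) = s + 1 then i
      else if 1 + s + (1 + s + x) < 2 * (s + 1) then s + 1 else 0) = 0 := by
    intro x
    rw [if_neg (by omega), if_neg (by omega), if_neg (by omega), if_neg (by omega)]
  rw [Finset.sum_congr rfl e1, Finset.sum_congr rfl e2]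
  simp only [e3]
  simp [add_comm 1 s]
  ring

/-- A good order is determined by the positions of the labels `t` and `0`. -/
lemma IsGoodOrder.eq_of_eq {P' : Equiv.Perm (Fin (3 * t))} (h : IsGoodOrder t P)
    (h' : IsGoodOrder t P') {m z : Fin (3 * t)} (hm : (m : ℕ) = t) (hz : (z : ℕ) = 0)
    (e : P m = P' m) (e' : P z = P' z) : P = P' := by
  suffices key : ∀ x y, x < y → (P x < P y ↔ P' x < P' y) by
    ext x
    rw [← P.card_filter_lt, ← P'.card_filter_lt]
    congr 2
    ext b
    rcases lt_trichotomy b x with hb | rfl | hb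
    · exact key b x hb
    · simp
    · have := key x b hb
      have h1 := P.injective.ne hb.ne
      have h2 := P'.injective.ne hb.ne
      constructor
      · intro hlt
        have := this.not.1 hlt.not_gt
        order
      · intro hlt
        have := this.not.2 hlt.not_gt
        order
  intro x y hxy
  suffices P y < P x ↔ P' y < P' x by
    have h1 := P.injective.ne hxy.ne
    have h2 := P'.injective.ne hxy.ne
    rw [← h1.le_iff_lt, ← h2.le_iff_lt, ← not_lt, ← not_lt, this]
  have hy := y.2
  by_cases hr : (y : ℕ) < t ∨ (t ≤ (x : ℕ) ∧ (y : ℕ) < 2 * t) ∨ 2 * t ≤ (x : ℕ)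
  · exact iff_of_false (h.row x y hxy hr).not_gt (h'.row x y hxy hr).not_gt
  by_cases hx0 : (x : ℕ) = 0
  · obtain rfl : x = z := Fin.ext (hx0.trans hz.symm)
    by_cases hy1 : (y : ℕ) = t
    · exact iff_of_true (h.mid_bot x y hx0 hy1) (h'.mid_bot x y hx0 hy1)
    by_cases hy2 : (y : ℕ) < 2 * t
    · rw [h.mid_lt_zero_iff hz (by omega) hy2, h'.mid_lt_zero_iff hz (by omega) hy2, e']
    · rw [h.top_lt_zero_iff hz (by omega), h'.top_lt_zero_iff hz (by omega), e']
  by_cases hx1 : (x : ℕ) < t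
  · exact iff_of_true (h.rest_bot x y (by omega) hx1 (by omega))
      (h'.rest_bot x y (by omega) hx1 (by omega))
  by_cases hx2 : (x : ℕ) = t
  · obtain rfl : x = m := Fin.ext (hx2.trans hm.symm)
    rw [h.top_lt_mid_iff hm (by omega), h'.top_lt_mid_iff hm (by omega), e]
  · exact iff_of_true (h.top_mid x y (by omega) (by omega) (by omega))
      (h'.top_mid x y (by omega) (by omega) (by omega))

end Counting

section Existence

/-- The position of the label `a ≥ t` among the labels `≥ t` in the good order placing the
label `t` at `i`. -/
def upperPos (t i a : ℕ) : ℕ :=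
  if a = t then i else if a < 2 * t then a else if a < 2 * t + i then a - 2 * t else a - 2 * t + 1

/-- The position of the label `a` in the good order placing the label `t` at `i` and the
label `0` at `r`, where `i < r`. -/
def goodPos (t i r a : ℕ) : ℕ :=
  if a = 0 then r else if a < t then 2 * t + a else
    if upperPos t i a < r then upperPos t i a else upperPos t i a + 1

lemma upperPos_lt {t i a : ℕ} (hr : i < 2 * t) (ha : a < 3 * t) :
    upperPos t i a < 2 * t := by
  unfold upperPos
  split_ifs <;> omega

lemma upperPos_inj {t i a b : ℕ} (hit : i ≤ t) (hta : t ≤ a) (ha : a < 3 * t)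
    (htb : t ≤ b) (hb : b < 3 * t) (h : upperPos t i a = upperPos t i b) : a = b := by
  unfold upperPos at h
  split_ifs at h <;> omega

lemma upperPos_lt_upperPos {t i a b : ℕ} (hit : i ≤ t) (hab : a < b) (hta : t ≤ a)
    (h : b < 2 * t ∨ 2 * t ≤ a) :
    upperPos t i a < upperPos t i b := by
  unfold upperPos
  split_ifs <;> omega

lemma upperPos_top_lt_mid {t i a b : ℕ} (hta : t < a) (ha : a < 2 * t) (hb : 2 * t ≤ b)
    (hb' : b < 3 * t) : upperPos t i b < upperPos t i a := by
  unfold upperPos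
  split_ifs <;> omega

lemma upperPos_self (t i : ℕ) : upperPos t i t = i := if_pos rfl

lemma upperPos_two_mul {t i : ℕ} (ht : 1 ≤ t) (hi : 1 ≤ i) : upperPos t i (2 * t) = 0 := by
  unfold upperPos
  split_ifs <;> omega

lemma goodPos_lt_goodPos {t i r a b : ℕ} (hta : t ≤ a) (htb : t ≤ b) (ht : 1 ≤ t)
    (h : upperPos t i a < upperPos t i b) : goodPos t i r a < goodPos t i r b := by
  unfold goodPos
  split_ifs <;> omega

lemma goodPos_lt {t i r a : ℕ} (hi : 1 ≤ i) (hir : i < r) (hr : r ≤ 2 * t)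
    (ha : a < 3 * t) : goodPos t i r a < 3 * t := by
  have := upperPos_lt (i := i) (by omega) ha
  unfold goodPos
  split_ifs <;> omega

lemma goodPos_inj {t i r a b : ℕ} (hi : 1 ≤ i) (hit : i ≤ t) (hir : i < r) (hr : r ≤ 2 * t)
    (ha : a < 3 * t) (hb : b < 3 * t) (h : goodPos t i r a = goodPos t i r b) : a = b := by
  have h1 := upperPos_lt (i := i) (by omega) ha
  have h2 := upperPos_lt (i := i) (by omega) hb
  by_cases hab : t ≤ a ∧ t ≤ b
  · refine upperPos_inj hit hab.1 ha hab.2 hb ?_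
    unfold goodPos at h
    split_ifs at h <;> omega
  · unfold goodPos at h
    split_ifs at h <;> omega

lemma exists_isGoodOrder {t i r : ℕ} (hi : 1 ≤ i) (hit : i ≤ t) (hir : i < r) (hr : r ≤ 2 * t)
    {m z : Fin (3 * t)} (hm : (m : ℕ) = t) (hz : (z : ℕ) = 0) :
    ∃ P : Equiv.Perm (Fin (3 * t)), IsGoodOrder t P ∧ (P m : ℕ) = i ∧ (P z : ℕ) = r := by
  let f : Fin (3 * t) → Fin (3 * t) := fun a => ⟨goodPos t i r a, goodPos_lt hi hir hr a.2⟩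
  have hf : Function.Injective f := fun a b hab =>
    Fin.ext (goodPos_inj hi hit hir hr a.2 b.2 (congrArg Fin.val hab))
  have hzero : goodPos t i r 0 = r := if_pos rfl
  have hmid : goodPos t i r t = i := by
    rw [goodPos, if_neg (by omega), if_neg (by omega), upperPos_self, if_pos hir]
  have hbot : ∀ a, 0 < a → a < t → goodPos t i r a = 2 * t + a := by
    intro a h1 h2
    rw [goodPos, if_neg (by omega), if_pos h2]
  refine ⟨Equiv.ofBijective f (Finite.injective_iff_bijective.1 hf), ⟨?_, ?_, ?_, ?_, ?_⟩, ?_, ?_⟩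
  · intro a b hab h
    change goodPos t i r a < goodPos t i r b
    rw [Fin.lt_def] at hab
    by_cases ha : t ≤ (a : ℕ)
    · exact goodPos_lt_goodPos ha (by omega) (by omega)
        (upperPos_lt_upperPos hit hab ha (by omega))
    · rw [hbot b (by omega) (by omega)]
      rcases Nat.eq_zero_or_pos (a : ℕ) with h0 | h0
      · rw [h0, hzero]
        omega
      · rw [hbot a h0 (by omega)]
        omega
  · intro a b h1 h2 h3
    exact goodPos_lt_goodPos (by omega) (by omega) (by omega) (upperPos_top_lt_mid h1 h2 h3 b.2)
  · intro a b h1 h2 h3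
    change goodPos t i r b < goodPos t i r a
    have := upperPos_lt (i := i) (by omega) b.2
    rw [hbot a h1 h2, goodPos, if_neg (by omega), if_neg (by omega)]
    split_ifs <;> omega
  · intro a b h1 h2
    change goodPos t i r b < goodPos t i r a
    rwa [h1, h2, hzero, hmid]
  · intro a b h1 h2
    refine goodPos_lt_goodPos (by omega) (by omega) (by omega) ?_
    rw [h1, h2, upperPos_self, upperPos_two_mul (by omega) hi]
    omega
  · change goodPos t i r m = i
    rw [hm, hmid]
  · change goodPos t i r z = r
    rw [hz, hzero]

end Existence

section GeneratingFunction

lemma NPoly_three_eq_sum (t : ℕ) (ht : 1 ≤ t) :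
    NPoly 3 t pat1243 = ∑ i ∈ Finset.range t, ∑ r ∈ Finset.Ico (i + 2) (2 * t + 1),
      (X : Polynomial ℤ) ^ (3 * t * (t - 1) + (i + 1) + r) := by
  classical
  let m : Fin (3 * t) := ⟨t, by omega⟩
  let z : Fin (3 * t) := ⟨0, by omega⟩
  have hm : (m : ℕ) = t := rfl
  have hz : (z : ℕ) = 0 := rfl
  rw [NPoly, Finset.sum_sigma']
  have mem : ∀ w ∈ Finset.univ.filter (fun w : Equiv.Perm (Fin (3 * t)) =>
      IsLinExtN 3 t w ∧ ¬ PermContains w pat1243), IsGoodOrder t w.symm := by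
    intro w hw
    exact isLinExtN_and_avoids_iff.1 (Finset.mem_filter.1 hw).2
  refine Finset.sum_bij (fun w _ => ⟨(w.symm m : ℕ) - 1, (w.symm z : ℕ)⟩) ?_ ?_ ?_ ?_
  · intro w hw
    have h := mem w hw
    have h1 := h.mid_pos hm
    have h2 := h.mid_le hm
    have h3 := h.zero_le hz
    have h4 := h.mid_bot z m hz hm
    rw [Fin.lt_def] at h4
    simp only [Finset.mem_sigma, Finset.mem_range, Finset.mem_Ico]
    omega
  · intro w hw w' hw' heq
    have h := mem w hw
    have h' := mem w' hw'
    have h1 := h.mid_pos hm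
    have h1' := h'.mid_pos hm
    simp only [Sigma.mk.injEq, heq_eq_eq] at heq
    have := h.eq_of_eq h' hm hz (Fin.ext (by omega)) (Fin.ext heq.2)
    simpa using congrArg Equiv.symm this
  · rintro ⟨i, r⟩ hir
    simp only [Finset.mem_sigma, Finset.mem_range, Finset.mem_Ico] at hir
    obtain ⟨P, hP, h1, h2⟩ := exists_isGoodOrder (t := t) (i := i + 1) (r := r) (by omega)
      (by omega) (by omega) (by omega) hm hz
    refine ⟨P.symm, ?_, ?_⟩
    · rw [Finset.mem_filter]
      exact ⟨Finset.mem_univ _, isLinExtN_and_avoids_iff.2 (by simpa using hP)⟩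
    · simp [h1, h2]
  · intro w hw
    have h := mem w hw
    have h1 := h.mid_pos hm
    rw [h.invCount_eq hm hz]
    simp only
    congr 2
    omega

lemma one_sub_mul_sum_Ico_pow {R : Type*} [CommRing R] (x : R) {a b : ℕ} (hab : a ≤ b) :
    (1 - x) * ∑ r ∈ Finset.Ico a b, x ^ r = x ^ a - x ^ b := by
  induction b, hab using Nat.le_induction with
  | base => simp
  | succ b hb ih =>
    rw [Finset.sum_Ico_succ_top hb, mul_add, ih]
    ring

lemma sum_sum_pow_identity {R : Type*} [CommRing R] (x : R) (s : ℕ) :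
    (1 - x) * (1 - x ^ 2) * ∑ i ∈ Finset.range (s + 1),
      ∑ r ∈ Finset.Ico (i + 2) (2 * (s + 1) + 1), x ^ (i + r) =
    x ^ 2 * (1 - x ^ (2 * s + 1) - 2 * x ^ (2 * s + 2) + x ^ (3 * s + 2) + x ^ (3 * s + 3)) := by
  have h1 : (1 - x) * ∑ i ∈ Finset.range (s + 1),
      ∑ r ∈ Finset.Ico (i + 2) (2 * (s + 1) + 1), x ^ (i + r) =
      x ^ 2 * ∑ i ∈ Finset.range (s + 1), (x ^ 2) ^ i -
        x ^ (2 * s + 3) * ∑ i ∈ Finset.range (s + 1), x ^ i := by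
    rw [Finset.mul_sum, Finset.mul_sum, Finset.mul_sum, ← Finset.sum_sub_distrib]
    refine Finset.sum_congr rfl fun i hi => ?_
    rw [Finset.mem_range] at hi
    simp only [pow_add x i]
    rw [← Finset.mul_sum, mul_left_comm, one_sub_mul_sum_Ico_pow x (by omega)]
    ring
  have h2 := mul_neg_geom_sum x (s + 1)
  have h3 := mul_neg_geom_sum (x ^ 2) (s + 1)
  rw [mul_right_comm, h1]
  linear_combination x ^ 2 * h3 - x ^ (2 * s + 3) * (1 + x) * h2

end GeneratingFunction

/-- **Theorem 2.** For all `t ≥ 1`,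
`(1−q)(1−q²) N_{3,t}(1243)(q) = q^{3(t²−t+1)} (1 − q^{2t−1} − 2q^{2t} + q^{3t−1} + q^{3t})`. -/
theorem NPoly_three_t_1243 (t : ℕ) (ht : 1 ≤ t) :
    (1 - X) * (1 - X ^ 2) * NPoly 3 t pat1243 =
      X ^ (3 * (t ^ 2 - t + 1)) *
        (1 - X ^ (2 * t - 1) - 2 * X ^ (2 * t) + X ^ (3 * t - 1) + X ^ (3 * t)) := by
  rw [NPoly_three_eq_sum t ht]
  obtain ⟨s, rfl⟩ : ∃ s, t = s + 1 := ⟨t - 1, by omega⟩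
  have e1 : (s + 1) ^ 2 - (s + 1) + 1 = s * (s + 1) + 1 := by
    rw [show (s + 1) ^ 2 = s * (s + 1) + (s + 1) by ring, Nat.add_sub_cancel]
  have e2 : ∀ i r, (X : Polynomial ℤ) ^ (3 * (s + 1) * (s + 1 - 1) + (i + 1) + r) =
      X ^ (3 * (s * (s + 1)) + 1) * X ^ (i + r) := by
    intro i r
    rw [← pow_add, Nat.add_sub_cancel]
    congr 1
    ring
  simp only [e2, ← Finset.mul_sum]
  rw [mul_left_comm, sum_sum_pow_identity, e1, show 2 * (s + 1) - 1 = 2 * s + 1 by omega,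
    show 3 * (s + 1) - 1 = 3 * s + 2 by omega]
  ring
end

section
/- For all integers s ≥ 1, N_{s,2}(2143)(q) = q^{(2s−1)(s−1)}(1+q)^{s−1} as polynomials in q. -/
open Polynomial

/-- The pairs of labels `a < b` of the two-column poset that occur in increasing order in a
`2143`-avoiding linear extension: always `(2k, 2k+1)`, and `(2k, 2k+3)` unless `k ∈ T`. -/
def NonInvPair (T : Finset ℕ) (a b : ℕ) : Prop :=
  a % 2 = 0 ∧ (b = a + 1 ∨ b = a + 3 ∧ a / 2 ∉ T)

/-- The noninversions of `w`, as pairs of labels, are those prescribed by `T`. -/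
def HasNonInv {n : ℕ} (T : Finset ℕ) (w : Equiv.Perm (Fin n)) : Prop :=
  ∀ a b : Fin n, a < b → (w.symm a < w.symm b ↔ NonInvPair T a b)

theorem HasNonInv.perm_unique {n : ℕ} {T : Finset ℕ} {w v : Equiv.Perm (Fin n)}
    (hw : HasNonInv T w) (hv : HasNonInv T v) : w = v := by
  have key : ∀ a b, w.symm a < w.symm b → v.symm a < v.symm b := by
    intro a b hab
    rcases lt_trichotomy a b with h | h | h
    · exact (hv a b h).2 ((hw a b h).1 hab)
    · subst h; exact absurd hab (lt_irrefl _)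
    · have h1 : ¬ v.symm b < v.symm a := fun h2 =>
        lt_asymm hab ((hw b a h).2 ((hv b a h).1 h2))
      exact lt_of_le_of_ne (not_lt.1 h1) fun h2 => h.ne' (v.symm.injective h2)
  have hmono : StrictMono (fun x => v.symm (w x)) := fun x y hxy => key _ _ (by simpa using hxy)
  have hid : (fun x => v.symm (w x)) = id :=
    hmono.range_inj strictMono_id |>.1 <| by
      rw [Set.range_id]
      exact (v.symm.surjective.comp w.surjective).range_eq
  ext x
  have := congrFun hid x
  rw [id, Equiv.symm_apply_eq] at this
  rw [this]

theorem HasNonInv.set_unique {s : ℕ} {T U : Finset ℕ} {w : Equiv.Perm (Fin (s * 2))}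
    (hT : T ⊆ Finset.range (s - 1)) (hU : U ⊆ Finset.range (s - 1))
    (hwT : HasNonInv T w) (hwU : HasNonInv U w) : T = U := by
  ext k
  by_cases hk : k < s - 1
  · have h := (hwT ⟨2 * k, by omega⟩ ⟨2 * k + 3, by omega⟩ (by simp)).symm.trans
      (hwU ⟨2 * k, by omega⟩ ⟨2 * k + 3, by omega⟩ (by simp))
    simpa [NonInvPair, not_iff_not] using h
  · exact ⟨fun h => absurd (Finset.mem_range.1 (hT h)) hk,
      fun h => absurd (Finset.mem_range.1 (hU h)) hk⟩

theorem HasNonInv.isLinExtN {s : ℕ} {T : Finset ℕ} {w : Equiv.Perm (Fin (s * 2))}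
    (h : HasNonInv T w) : IsLinExtN s 2 w := by
  refine ⟨fun a b hab hdvd => ?_, fun a b hab => ?_⟩
  · exact (h a b (by omega)).2 ⟨by omega, Or.inl hab⟩
  · have h1 : ¬ w.symm b < w.symm a := by
      rw [h b a (by omega)]
      rintro ⟨_, h | h⟩ <;> omega
    exact lt_of_le_of_ne (not_lt.1 h1) fun h2 => by
      have := w.symm.injective h2
      subst this
      omega

theorem HasNonInv.not_permContains {n : ℕ} {T : Finset ℕ} {w : Equiv.Perm (Fin n)}
    (h : HasNonInv T w) : ¬ PermContains w pat2143 := by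
  rintro ⟨f, hf, hp⟩
  have before : ∀ i j : Fin 4, i < j → pat2143 i < pat2143 j →
      NonInvPair T (w (f i)) (w (f j)) := fun i j hij hlt =>
    (h _ _ ((hp i j).2 hlt)).1 (by simpa using hf hij)
  have h02 := before 0 2 (by decide) (by decide)
  have h03 := before 0 3 (by decide) (by decide)
  have h12 := before 1 2 (by decide) (by decide)
  have h13 := before 1 3 (by decide) (by decide)
  have h10 : (w (f 1) : ℕ) < w (f 0) := (hp 1 0).2 (by decide)
  have h32 : (w (f 3) : ℕ) < w (f 2) := (hp 3 2).2 (by decide)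
  unfold NonInvPair at *
  omega

theorem IsLinExtN.symm_lt_of_sub_even {s : ℕ} {w : Equiv.Perm (Fin (s * 2))}
    (h : IsLinExtN s 2 w) {a b : Fin (s * 2)} (hab : a < b) (hpar : (a : ℕ) % 2 = b % 2) :
    w.symm b < w.symm a := by
  have key : ∀ (d : ℕ) (a b : Fin (s * 2)), (b : ℕ) = a + 2 * (d + 1) →
      w.symm b < w.symm a := by
    intro d
    induction d with
    | zero => exact fun a b hb => h.2 b a (by omega)
    | succ d ih =>
      intro a b hb
      exact (h.2 b ⟨b - 2, by omega⟩ (by simp only; omega)).trans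
        (ih a ⟨b - 2, by omega⟩ (by simp only; omega))
  exact key ((b - a) / 2 - 1) a b (by omega)

theorem IsLinExtN.symm_lt_of_not_permContains {s : ℕ} {w : Equiv.Perm (Fin (s * 2))}
    (h : IsLinExtN s 2 w) (hav : ¬ PermContains w pat2143) {a b : Fin (s * 2)}
    (ha : (a : ℕ) % 2 = 0) (hab : (b : ℕ) = a + 5) : w.symm b < w.symm a := by
  by_contra hcon
  have hlt : w.symm a < w.symm b := lt_of_le_of_ne (not_lt.1 hcon) fun h2 => by
    have := w.symm.injective h2
    subst this
    omega
  let c : Fin (s * 2) := ⟨a + 2, by omega⟩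
  let d : Fin (s * 2) := ⟨a + 3, by omega⟩
  have hca : w.symm c < w.symm a :=
    h.symm_lt_of_sub_even (by simp [c, Fin.lt_def]) (by simp [c])
  have hbd : w.symm b < w.symm d :=
    h.symm_lt_of_sub_even (by simp [d, Fin.lt_def, hab]) (by simp only [d]; omega)
  refine hav ⟨![w.symm c, w.symm a, w.symm b, w.symm d], ?_, ?_⟩
  · rw [Fin.strictMono_iff_lt_succ]
    intro i
    fin_cases i
    · exact hca
    · exact hlt
    · exact hbd
  · intro j k
    fin_cases j <;> fin_cases k <;> simp [pat2143, c, d, Fin.lt_def, hab]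

theorem IsLinExtN.exists_hasNonInv {s : ℕ} {w : Equiv.Perm (Fin (s * 2))}
    (h : IsLinExtN s 2 w) (hav : ¬ PermContains w pat2143) :
    ∃ T ⊆ Finset.range (s - 1), HasNonInv T w := by
  classical
  let T : Finset ℕ := (Finset.range (s - 1)).filter fun k =>
    ∃ a b : Fin (s * 2), (a : ℕ) = 2 * k ∧ (b : ℕ) = 2 * k + 3 ∧ w.symm b < w.symm a
  refine ⟨T, Finset.filter_subset _ _, fun a b hab => ?_⟩
  have hab' : (a : ℕ) < b := hab
  by_cases ha : (a : ℕ) % 2 = 0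
  · by_cases hb : (b : ℕ) % 2 = 0
    · refine iff_of_false (lt_asymm (h.symm_lt_of_sub_even hab (by omega))) ?_
      rintro ⟨_, h | h⟩ <;> omega
    · by_cases h1 : (b : ℕ) = a + 1
      · exact iff_of_true (h.1 a b h1 (by omega)) ⟨ha, Or.inl h1⟩
      by_cases h3 : (b : ℕ) = a + 3
      · have hT : (a : ℕ) / 2 ∈ T ↔ w.symm b < w.symm a := by
          simp only [T, Finset.mem_filter, Finset.mem_range]
          constructor
          · rintro ⟨_, a', b', ha', hb', hlt⟩
            obtain rfl : a' = a := Fin.ext (by omega)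
            obtain rfl : b' = b := Fin.ext (by omega)
            exact hlt
          · exact fun hlt => ⟨by omega, a, b, by omega, by omega, hlt⟩
        have hne : w.symm a ≠ w.symm b := fun h2 => hab.ne (w.symm.injective h2)
        simp only [NonInvPair, hT, not_lt, ha, h3, true_and]
        simp [hne.le_iff_lt]
      · refine iff_of_false (lt_asymm ?_) ?_
        · let c : Fin (s * 2) := ⟨a + 5, by omega⟩
          have hc : w.symm c < w.symm a := h.symm_lt_of_not_permContains hav ha rfl
          by_cases hbc : b = c
          · rwa [hbc]
          · have hcb : c < b := by
              have : (b : ℕ) ≠ c := fun h2 => hbc (Fin.ext h2)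
              simp only [c] at this
              simp only [c, Fin.lt_def]
              omega
            exact (h.symm_lt_of_sub_even hcb (by simp only [c]; omega)).trans hc
        · rintro ⟨_, h | h⟩ <;> omega
  · refine iff_of_false (lt_asymm ?_) fun h => ha h.1
    by_cases hb : (b : ℕ) % 2 = 0
    · let c : Fin (s * 2) := ⟨a - 1, by omega⟩
      exact (h.symm_lt_of_sub_even (a := c) (b := b) (by simp only [c, Fin.lt_def]; omega)
        (by simp only [c]; omega)).trans (h.1 c a (by simp only [c]; omega)
          (by simp only [c]; omega))
    · exact h.symm_lt_of_sub_even hab (by omega)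

/-- The position of the label `a` in the linear extension whose noninversions are prescribed
by `T`. -/
def labelPos (s : ℕ) (T : Finset ℕ) (a : ℕ) : ℕ :=
  if a % 2 = 0 then
    if a + 2 = 2 * s then 0 else if a / 2 ∈ T then 2 * s - 2 - a else 2 * s - 3 - a
  else
    if a = 1 then 2 * s - 1 else if (a - 3) / 2 ∈ T then 2 * s - a else 2 * s + 1 - a

theorem labelPos_lt {s a : ℕ} (T : Finset ℕ) (ha : a < s * 2) : labelPos s T a < s * 2 := by
  unfold labelPos
  split_ifs <;> omega

theorem labelPos_lt_iff {s a b : ℕ} (T : Finset ℕ) (hab : a < b) (hb : b < s * 2) :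
    labelPos s T a < labelPos s T b ↔ NonInvPair T a b := by
  unfold labelPos NonInvPair
  by_cases h3 : b = a + 3
  · subst h3
    by_cases hT : a / 2 ∈ T <;> simp [hT] <;> split_ifs <;> omega
  · simp only [h3, false_and, or_false]
    split_ifs <;> omega

theorem labelPos_ne {s a b : ℕ} (T : Finset ℕ) (hab : a < b) (hb : b < s * 2) :
    labelPos s T a ≠ labelPos s T b := by
  unfold labelPos
  by_cases h3 : b = a + 3
  · subst h3
    by_cases hT : a / 2 ∈ T <;> simp only [Nat.add_sub_cancel, hT] <;> split_ifs <;> omega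
  · split_ifs <;> omega

theorem exists_perm_hasNonInv (s : ℕ) (T : Finset ℕ) :
    ∃ w : Equiv.Perm (Fin (s * 2)), HasNonInv T w := by
  let g : Fin (s * 2) → Fin (s * 2) := fun a => ⟨labelPos s T a, labelPos_lt T a.2⟩
  have hg : Function.Injective g := by
    intro a b hab
    have hab' : labelPos s T a = labelPos s T b := congrArg Fin.val hab
    by_contra hne
    rcases lt_or_gt_of_ne hne with h | h
    · exact labelPos_ne T h b.2 hab'
    · exact labelPos_ne T h a.2 hab'.symm
  exact ⟨(Equiv.ofBijective g (Finite.injective_iff_bijective.1 hg)).symm,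
    fun a b hab => labelPos_lt_iff T hab b.2⟩

theorem card_fin_pairs_lt (n : ℕ) :
    (Finset.univ.filter fun p : Fin n × Fin n => p.1 < p.2).card = n * (n - 1) / 2 := by
  rw [Finset.card_filter, Fintype.sum_prod_type_right]
  simp only [← Finset.card_filter]
  rw [← Finset.sum_range_id, ← Fin.sum_univ_eq_sum_range (fun i => i)]
  refine Finset.sum_congr rfl fun b _ => ?_
  rw [Finset.filter_gt_eq_Iio, Fin.card_Iio]

open Classical in
theorem card_nonInvPairs {s : ℕ} {T : Finset ℕ} (hT : T ⊆ Finset.range (s - 1)) :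
    (Finset.univ.filter fun p : Fin (s * 2) × Fin (s * 2) =>
      p.1 < p.2 ∧ NonInvPair T p.1 p.2).card + T.card = s + (s - 1) := by
  let ι : Fin (s * 2) × Fin (s * 2) → ℕ × ℕ := fun p => (p.1, p.2)
  have hι : Function.Injective ι := fun p q h => by
    simp only [ι, Prod.mk.injEq] at h
    exact Prod.ext (Fin.ext h.1) (Fin.ext h.2)
  have himage : (Finset.univ.filter fun p : Fin (s * 2) × Fin (s * 2) =>
      p.1 < p.2 ∧ NonInvPair T p.1 p.2).image ι =
      (Finset.range s).image (fun k => (2 * k, 2 * k + 1)) ∪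
        (Finset.range (s - 1) \ T).image (fun k => (2 * k, 2 * k + 3)) := by
    ext ⟨x, y⟩
    simp only [Finset.mem_image, Finset.mem_filter, Finset.mem_univ, true_and, Finset.mem_union,
      Finset.mem_range, Finset.mem_sdiff, Prod.mk.injEq, ι]
    constructor
    · rintro ⟨⟨a, b⟩, ⟨_, ha, h | ⟨h, hk⟩⟩, rfl, rfl⟩
      · exact Or.inl ⟨a / 2, by omega, by simp only at *; omega, by simp only at *; omega⟩
      · exact Or.inr ⟨a / 2, ⟨by simp only at *; omega, hk⟩, by simp only at *; omega,
          by simp only at *; omega⟩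
    · rintro (⟨k, hk, rfl, rfl⟩ | ⟨k, ⟨hk, hkT⟩, rfl, rfl⟩)
      · exact ⟨(⟨2 * k, by omega⟩, ⟨2 * k + 1, by omega⟩), ⟨by simp, by simp [NonInvPair]⟩,
          rfl, rfl⟩
      · exact ⟨(⟨2 * k, by omega⟩, ⟨2 * k + 3, by omega⟩),
          ⟨by simp, by simp [NonInvPair, hkT]⟩, rfl, rfl⟩
  rw [← Finset.card_image_of_injective _ hι, himage, Finset.card_union_of_disjoint,
    Finset.card_image_of_injective, Finset.card_image_of_injective, Finset.card_range,
    add_assoc, Finset.card_sdiff_add_card_eq_card hT, Finset.card_range]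
  · intro i j hij
    simpa using hij
  · intro i j hij
    simpa using hij
  · rw [Finset.disjoint_left]
    intro p hp hp'
    simp only [Finset.mem_image] at hp hp'
    obtain ⟨i, _, rfl⟩ := hp
    obtain ⟨j, _, hj⟩ := hp'
    simp only [Prod.mk.injEq] at hj
    omega

open Classical in
theorem invCount_eq_card_labels {n : ℕ} (w : Equiv.Perm (Fin n)) :
    invCount w = (Finset.univ.filter fun p : Fin n × Fin n =>
      p.1 < p.2 ∧ ¬ w.symm p.1 < w.symm p.2).card := by
  unfold invCount
  refine Finset.card_bij' (fun p _ => (w p.2, w p.1)) (fun p _ => (w.symm p.2, w.symm p.1))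
    ?_ ?_ ?_ ?_
  · rintro ⟨i, j⟩ h
    simp only [Finset.mem_filter, Finset.mem_univ, true_and] at h ⊢
    simpa using ⟨h.2, h.1.le⟩
  · rintro ⟨a, b⟩ h
    simp only [Finset.mem_filter, Finset.mem_univ, true_and] at h ⊢
    refine ⟨lt_of_le_of_ne (not_lt.1 h.2) fun h2 => h.1.ne' (w.symm.injective h2), ?_⟩
    simpa using h.1
  · simp
  · simp

theorem HasNonInv.invCount_eq {s : ℕ} (hs : 1 ≤ s) {T : Finset ℕ}
    {w : Equiv.Perm (Fin (s * 2))} (hT : T ⊆ Finset.range (s - 1)) (h : HasNonInv T w) :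
    invCount w = (2 * s - 1) * (s - 1) + T.card := by
  classical
  have hsplit := Finset.card_filter_add_card_filter_not
    (s := Finset.univ.filter fun p : Fin (s * 2) × Fin (s * 2) => p.1 < p.2)
    (fun p => w.symm p.1 < w.symm p.2)
  rw [Finset.filter_filter, Finset.filter_filter, ← invCount_eq_card_labels,
    card_fin_pairs_lt] at hsplit
  have hcongr : (Finset.univ.filter fun p : Fin (s * 2) × Fin (s * 2) =>
      p.1 < p.2 ∧ w.symm p.1 < w.symm p.2) =
      Finset.univ.filter fun p : Fin (s * 2) × Fin (s * 2) =>
        p.1 < p.2 ∧ NonInvPair T p.1 p.2 :=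
    Finset.filter_congr fun p _ => and_congr_right fun hp => h p.1 p.2 hp
  have hcard := card_nonInvPairs hT
  rw [hcongr] at hsplit
  obtain ⟨r, rfl⟩ : ∃ r, s = r + 1 := ⟨s - 1, by omega⟩
  have htot : (r + 1) * 2 * ((r + 1) * 2 - 1) / 2 = (2 * r + 1) * r + (2 * r + 1) := by
    rw [show (r + 1) * 2 - 1 = 2 * r + 1 by omega]
    exact Nat.div_eq_of_eq_mul_left two_pos (by ring)
  rw [htot] at hsplit
  rw [show 2 * (r + 1) - 1 = 2 * r + 1 by omega, Nat.add_sub_cancel]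
  omega

/-- **Theorem 3.** For all `s ≥ 1`, `N_{s,2}(2143)(q) = q^{(2s−1)(s−1)} (1+q)^{s−1}`. -/
theorem NPoly_s_two_2143 (s : ℕ) (hs : 1 ≤ s) :
    NPoly s 2 pat2143 = X ^ ((2 * s - 1) * (s - 1)) * (1 + X) ^ (s - 1) := by
  classical
  choose v hv using exists_perm_hasNonInv s
  have hsum : NPoly s 2 pat2143 = ∑ T ∈ (Finset.range (s - 1)).powerset,
      (X : Polynomial ℤ) ^ ((2 * s - 1) * (s - 1) + T.card) := by
    symm
    unfold NPoly
    refine Finset.sum_bij (fun T _ => v T) ?_ ?_ ?_ ?_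
    · intro T _
      simpa using ⟨(hv T).isLinExtN, (hv T).not_permContains⟩
    · intro T hT U hU hTU
      exact (hv T).set_unique (Finset.mem_powerset.1 hT) (Finset.mem_powerset.1 hU)
        (hTU ▸ hv U)
    · intro w hw
      simp only [Finset.mem_filter, Finset.mem_univ, true_and] at hw
      obtain ⟨T, hT, hwT⟩ := hw.1.exists_hasNonInv hw.2
      exact ⟨T, Finset.mem_powerset.2 hT, (hv T).perm_unique hwT⟩
    · intro T hT
      rw [(hv T).invCount_eq hs (Finset.mem_powerset.1 hT)]
  have hbinom := Finset.sum_pow_mul_eq_add_pow (X : Polynomial ℤ) 1 (Finset.range (s - 1))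
  simp only [one_pow, mul_one, Finset.card_range] at hbinom
  rw [hsum, add_comm 1 X, ← hbinom, Finset.mul_sum]
  simp only [pow_add]
end

section
/- For all integers s ≥ 1, the number of linear extensions of N_{s,2} that avoid the pattern 2143 is 2^{s−1}. -/
open Polynomial

/-- The involution of `Fin (s * 2)` listing the labels of `N_{s,2}` in the order
`2s-2, 2s-1, 2s-4, 2s-3, …` with the labels in positions `2k+1` and `2k+2` forming a block. -/
def blockOrder (s : ℕ) : Equiv.Perm (Fin (s * 2)) :=
  Function.Involutive.toPerm
    (fun q => if h : (q : ℕ) % 2 = 1 then ⟨s * 2 - q, by omega⟩ else ⟨s * 2 - 2 - q, by omega⟩)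
    (by
      intro q
      have hq := q.2
      rcases Nat.mod_two_eq_zero_or_one (q : ℕ) with h | h
      · have h' : (s * 2 - 2 - (q : ℕ)) % 2 = 0 := by omega
        ext
        simp [h, h']
        omega
      · have h' : (s * 2 - (q : ℕ)) % 2 = 1 := by omega
        ext
        simp [h, h']
        omega)

lemma blockOrder_val (s : ℕ) (q : Fin (s * 2)) :
    (blockOrder s q : ℕ) = if (q : ℕ) % 2 = 1 then s * 2 - q else s * 2 - 2 - q := by
  split_ifs with h
  · exact congrArg Fin.val (dif_pos h)
  · exact congrArg Fin.val (dif_neg h)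

lemma blockOrder_blockOrder (s : ℕ) (q : Fin (s * 2)) : blockOrder s (blockOrder s q) = q :=
  Function.Involutive.toPerm_involutive _ q

/-- The block of a position: `{0}, {1, 2}, {3, 4}, …`. -/
def block (s : ℕ) (q : Fin (s * 2)) : Fin (s + 1) := ⟨((q : ℕ) + 1) / 2, by omega⟩

/-- A permutation of `Fin (s * 2)` mapping each block before the next one preserves blocks. -/
lemma block_eq_of_lt {s : ℕ} (r : Equiv.Perm (Fin (s * 2)))
    (h : ∀ a b : Fin (s * 2), ((a : ℕ) + 1) / 2 + 1 = ((b : ℕ) + 1) / 2 → r a < r b)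
    (a : Fin (s * 2)) : ((r a : ℕ) + 1) / 2 = ((a : ℕ) + 1) / 2 := by
  have hne : ∀ a b : Fin (s * 2), (a : ℕ) ≠ b → (r a : ℕ) ≠ r b := by
    intro a b hab heq
    exact hab (congrArg Fin.val (r.injective (Fin.ext heq)))
  have lower : ∀ k : ℕ, ∀ a : Fin (s * 2), ((a : ℕ) + 1) / 2 = k → 2 * k ≤ (r a : ℕ) + 1 := by
    intro k
    induction k with
    | zero => intros; omega
    | succ k ih =>
      intro a ha
      have := a.2
      rcases Nat.eq_zero_or_pos k with rfl | hk
      · have := h ⟨0, by omega⟩ a (by simp; omega)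
        rw [Fin.lt_def] at this
        omega
      · have h1 := h ⟨2 * k - 1, by omega⟩ a (by simp; omega)
        have h2 := h ⟨2 * k, by omega⟩ a (by simp; omega)
        have h3 := hne ⟨2 * k - 1, by omega⟩ ⟨2 * k, by omega⟩ (by simp; omega)
        have h4 := ih ⟨2 * k - 1, by omega⟩ (by simp; omega)
        have h5 := ih ⟨2 * k, by omega⟩ (by simp; omega)
        rw [Fin.lt_def] at h1 h2
        omega
  have upper : ∀ j : ℕ, ∀ a : Fin (s * 2), ((a : ℕ) + 1) / 2 + j = s →
      (r a : ℕ) + 2 * j ≤ 2 * s := by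
    intro j
    induction j with
    | zero => intro a _; have := (r a).2; omega
    | succ j ih =>
      intro a ha
      have := a.2
      rcases Nat.eq_zero_or_pos j with rfl | hj
      · have h1 := h a ⟨s * 2 - 1, by omega⟩ (by simp; omega)
        have h2 := (r ⟨s * 2 - 1, by omega⟩).2
        rw [Fin.lt_def] at h1
        omega
      · have h1 := h a ⟨2 * (s - j) - 1, by omega⟩ (by simp; omega)
        have h2 := h a ⟨2 * (s - j), by omega⟩ (by simp; omega)
        have h3 := hne ⟨2 * (s - j) - 1, by omega⟩ ⟨2 * (s - j), by omega⟩ (by simp; omega)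
        have h4 := ih ⟨2 * (s - j) - 1, by omega⟩ (by simp; omega)
        have h5 := ih ⟨2 * (s - j), by omega⟩ (by simp; omega)
        rw [Fin.lt_def] at h1 h2
        omega
  have h1 := lower _ a rfl
  have h2 := upper (s - ((a : ℕ) + 1) / 2) a (by omega)
  omega

lemma symm_lt_symm_of_block {s : ℕ} {w : Equiv.Perm (Fin (s * 2))} (hw : IsLinExtN s 2 w)
    (hav : ¬ PermContains w pat2143) (a b : Fin (s * 2))
    (hab : ((a : ℕ) + 1) / 2 + 1 = ((b : ℕ) + 1) / 2) :
    w.symm (blockOrder s a) < w.symm (blockOrder s b) := by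
  obtain ⟨hsucc, hsub⟩ := hw
  have hadd_two : ∀ a b : Fin (s * 2), (b : ℕ) = a + 2 →
      w.symm (blockOrder s a) < w.symm (blockOrder s b) := by
    intro a b hab
    apply hsub
    rw [blockOrder_val, blockOrder_val]
    split_ifs <;> omega
  have hadd_one : ∀ a b : Fin (s * 2), (a : ℕ) % 2 = 0 → (b : ℕ) = a + 1 →
      w.symm (blockOrder s a) < w.symm (blockOrder s b) := by
    intro a b ha hab
    apply hsucc <;> simp only [blockOrder_val]
    · split_ifs <;> omega
    · split_ifs <;> omega
  have ha := a.2
  have hb := b.2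
  have hcases : (b : ℕ) = a + 2 ∨ ((a : ℕ) % 2 = 0 ∧ (b : ℕ) = a + 1) ∨
      ((a : ℕ) % 2 = 1 ∧ (b : ℕ) = a + 3) := by omega
  rcases hcases with hc | ⟨hp, hc⟩ | ⟨hp, hc⟩
  · exact hadd_two a b hc
  · exact hadd_one a b hp hc
  by_contra hlt
  have hne : w.symm (blockOrder s a) ≠ w.symm (blockOrder s b) := by
    intro heq
    have := congrArg Fin.val ((blockOrder s).injective (w.symm.injective heq))
    omega
  have h12 : w.symm (blockOrder s b) < w.symm (blockOrder s a) :=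
    lt_of_le_of_ne (not_lt.mp hlt) hne.symm
  have h01 := hadd_two ⟨a + 1, by omega⟩ b hc
  have h23 := hadd_two a ⟨a + 2, by omega⟩ rfl
  refine hav ⟨![w.symm (blockOrder s ⟨a + 1, by omega⟩), w.symm (blockOrder s b),
    w.symm (blockOrder s a), w.symm (blockOrder s ⟨a + 2, by omega⟩)], ?_, ?_⟩
  · rw [Fin.strictMono_iff_lt_succ]
    intro i
    fin_cases i
    · exact h01
    · exact h12
    · exact h23
  · intro j k
    fin_cases j <;> fin_cases k <;>
      simp [pat2143, Fin.lt_def, blockOrder_val, Nat.add_mod, hp, hc] <;> omega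

lemma valid_iff_block {s : ℕ} (w : Equiv.Perm (Fin (s * 2))) :
    IsLinExtN s 2 w ∧ ¬ PermContains w pat2143 ↔
      block s ∘ (w.trans (blockOrder s)) = block s := by
  constructor
  · rintro ⟨hw, hav⟩
    funext q
    have := block_eq_of_lt ((blockOrder s).trans w.symm)
      (fun a b hab => symm_lt_symm_of_block hw hav a b hab) (blockOrder s (w q))
    ext
    simp only [Equiv.trans_apply, blockOrder_blockOrder, Equiv.symm_apply_apply] at this
    simp [block, this]
  · intro h
    have hpos : ∀ q, ((blockOrder s (w q) : ℕ) + 1) / 2 = ((q : ℕ) + 1) / 2 := by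
      intro q
      simpa [block] using congrArg Fin.val (congrFun h q)
    simp only [blockOrder_val] at hpos
    have hlab : ∀ a : Fin (s * 2), (((if (a : ℕ) % 2 = 1 then s * 2 - a else s * 2 - 2 - a : ℕ)) + 1) / 2 =
        ((w.symm a : ℕ) + 1) / 2 := by
      intro a
      simpa using hpos (w.symm a)
    refine ⟨⟨?_, ?_⟩, ?_⟩
    · intro a b hab hdvd
      have h1 := hlab a
      have h2 := hlab b
      rw [Fin.lt_def]
      split_ifs at h1 h2 <;> omega
    · intro a b hab
      have h1 := hlab a
      have h2 := hlab b
      rw [Fin.lt_def]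
      split_ifs at h1 h2 <;> omega
    · rintro ⟨f, hf, hv⟩
      have p01 : f 0 < f 1 := hf (by decide)
      have p12 : f 1 < f 2 := hf (by decide)
      have p23 : f 2 < f 3 := hf (by decide)
      have v10 : w (f 1) < w (f 0) := (hv 1 0).2 (by decide)
      have v03 : w (f 0) < w (f 3) := (hv 0 3).2 (by decide)
      have v32 : w (f 3) < w (f 2) := (hv 3 2).2 (by decide)
      have h0 := hpos (f 0)
      have h1 := hpos (f 1)
      have h2 := hpos (f 2)
      have h3 := hpos (f 3)
      rw [Fin.lt_def] at *
      split_ifs at h0 h1 h2 h3 <;> omega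

lemma prod_factorial_card_block (t : ℕ) :
    ∏ i, (Fintype.card {q // block (t + 1) q = i}).factorial = 2 ^ t := by
  rw [Fin.prod_univ_succ, Fin.prod_univ_castSucc]
  have h0 : Fintype.card {q // block (t + 1) q = 0} = 1 := by
    rw [Fintype.card_subtype, Finset.card_eq_one]
    refine ⟨⟨0, by omega⟩, ?_⟩
    ext q
    simp only [Finset.mem_filter, Finset.mem_univ, true_and, Finset.mem_singleton, block,
      Fin.ext_iff, Fin.val_zero]
    omega
  have hlast : Fintype.card {q // block (t + 1) q = (Fin.last t).succ} = 1 := by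
    rw [Fintype.card_subtype, Finset.card_eq_one]
    refine ⟨⟨2 * t + 1, by omega⟩, ?_⟩
    ext q
    simp [block, Fin.ext_iff]
    omega
  have hmid : ∀ k : Fin t, Fintype.card {q // block (t + 1) q = k.castSucc.succ} = 2 := by
    intro k
    rw [Fintype.card_subtype, Finset.card_eq_two]
    refine ⟨⟨2 * k + 1, by omega⟩, ⟨2 * k + 2, by omega⟩, by simp, ?_⟩
    ext q
    simp [block, Fin.ext_iff]
    omega
  rw [h0, hlast]
  simp [hmid]

/-- For all `s ≥ 1`, the number of linear extensions of `N_{s,2}` avoiding `2143`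
is `2^{s−1}`. -/
theorem card_s_two_2143 (s : ℕ) (hs : 1 ≤ s) :
    Nat.card {w : Equiv.Perm (Fin (s * 2)) // IsLinExtN s 2 w ∧ ¬ PermContains w pat2143} =
      2 ^ (s - 1) := by
  obtain ⟨t, rfl⟩ : ∃ t, s = t + 1 := ⟨s - 1, by omega⟩
  have e : {w : Equiv.Perm (Fin ((t + 1) * 2)) //
      IsLinExtN (t + 1) 2 w ∧ ¬ PermContains w pat2143} ≃
      {g : Equiv.Perm (Fin ((t + 1) * 2)) // block (t + 1) ∘ g = block (t + 1)} :=
    (Equiv.mulLeft (blockOrder (t + 1))).subtypeEquiv fun w => valid_iff_block w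
  rw [Nat.card_congr e, Nat.card_eq_fintype_card, DomMulAct.stabilizer_card,
    prod_factorial_card_block, Nat.add_sub_cancel]
end
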